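/- Let h be a gauge function, let w be a non-negative function in L^1(|dz|) on 𝕋, and let t, ε ∈ (0,∞). If ∫_E log w |dz| = -∞ for every h-Carleson set E ⊂ 𝕋 of positive Lebesgue (arclength) measure, then there exists a sequence of polynomials {p_N}_N in the complex variable z such that: (i) ∫_𝕋 |p_N|^t w |dz| → 0 as N → ∞; (ii) p_N → 1 uniformly on compact subsets of the unit disk 𝔻; and (iii) |p_N(z)| ≤ exp( ε · h(1-|z|)/(1-|z|) ) for all z ∈ 𝔻, uniformly in N. -/

import Mathlib

open MeasureTheory Set Filter Topology

noncomputable section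

local instance : Fact (0 < 2 * Real.pi) := ⟨by positivity⟩

/-- The unit circle `𝕋`, modelled as `ℝ / 2πℤ` with its arclength (Haar) measure,
of total mass `2π`. -/
abbrev UnitCircle := AddCircle (2 * Real.pi)

/-- A gauge function: continuous, increasing on `[0,∞)`, vanishing at `0`, with
`(R1)` `h x / x` decreasing and `(R2)` `h x / x → ∞` as `x → 0+`. -/
structure IsGauge (h : ℝ → ℝ) : Prop where
  continuousOn : ContinuousOn h (Set.Ici 0)
  mono : MonotoneOn h (Set.Ici 0)
  zero : h 0 = 0
  r1 : ∀ ⦃x y : ℝ⦄, 0 < x → x ≤ y → h y / y ≤ h x / x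
  r2 : Filter.Tendsto (fun x => h x / x) (nhdsWithin 0 (Set.Ioi 0)) Filter.atTop

/-- An arc of the circle: a connected subset (the empty set is allowed as a
degenerate arc). -/
def IsArc (I : Set UnitCircle) : Prop := IsPreconnected I

/-- An `h`-Carleson set: a closed subset of the circle whose complement is a countable
disjoint union of open arcs `I_k` (namely its maximal complementary arcs) with
`Σ_k h(|I_k|) < ∞`. -/
def IsHCarleson (h : ℝ → ℝ) (E : Set UnitCircle) : Prop :=
  IsClosed E ∧ ∃ I : ℕ → Set UnitCircle,
    (∀ k, IsOpen (I k) ∧ IsPreconnected (I k)) ∧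
    (∀ k l, k ≠ l → Disjoint (I k) (I l)) ∧
    (⋃ k, I k) = Eᶜ ∧
    (∑' k, ENNReal.ofReal (h (volume (I k)).toReal)) < ⊤

/-- `nlog t = log⁺(1/t)`, valued in `[0,∞]`, with `nlog 0 = ∞`. For `w ≥ 0` this is
the function `R = log⁺(1/w)` of Khrushchev; moreover, since the positive part of
`log w` is automatically integrable for `w ∈ L¹`, the divergence condition
`∫_E log w |dζ| = -∞` is faithfully expressed as `∫⁻_E nlog (w ζ) |dζ| = ∞`. -/
def nlog (t : ℝ) : ENNReal := if t = 0 then ⊤ else ENNReal.ofReal (Real.log t⁻¹)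

/-- The embedding of `𝕋 = ℝ/2πℤ` into `ℂ`, `θ ↦ e^{iθ}`. -/
def circleEmbed (ζ : UnitCircle) : ℂ := (AddCircle.toCircle ζ : ℂ)

/-- The Poisson kernel of the unit disk at `z`, evaluated at the boundary point `e^{ix}`. -/
def diskKernel (z : ℂ) (x : ℝ) : ℝ := poissonKernel 0 z (circleMap 0 1 x)

lemma diskKernel_eq (z : ℂ) (x : ℝ) :
    diskKernel z x = (1 - ‖z‖ ^ 2) / ‖circleMap 0 1 x - z‖ ^ 2 := by
  simp [diskKernel, poissonKernel_def]

lemma one_sub_norm_le_norm_circleMap_sub (z : ℂ) (x : ℝ) :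
    1 - ‖z‖ ≤ ‖circleMap 0 1 x - z‖ := by
  have := norm_sub_norm_le (circleMap 0 1 x) z
  simpa using this

lemma diskKernel_pos {z : ℂ} (hz : ‖z‖ < 1) (x : ℝ) : 0 < diskKernel z x := by
  rw [diskKernel_eq]
  have h1 := one_sub_norm_le_norm_circleMap_sub z x
  have h2 := norm_nonneg z
  have : 0 < ‖circleMap 0 1 x - z‖ := by linarith
  apply div_pos
  · nlinarith
  · positivity

lemma continuous_diskKernel {z : ℂ} (hz : ‖z‖ < 1) : Continuous (diskKernel z) := by
  have : diskKernel z = fun x => (1 - ‖z‖ ^ 2) / ‖circleMap 0 1 x - z‖ ^ 2 :=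
    funext (diskKernel_eq z)
  rw [this]
  refine Continuous.div continuous_const (by fun_prop) ?_
  intro x
  have h1 := one_sub_norm_le_norm_circleMap_sub z x
  have : 0 < ‖circleMap 0 1 x - z‖ := by linarith
  positivity

lemma diskKernel_le {z : ℂ} (hz : ‖z‖ < 1) (x : ℝ) : diskKernel z x ≤ 2 / (1 - ‖z‖) := by
  rw [diskKernel_eq]
  have h1 := one_sub_norm_le_norm_circleMap_sub z x
  have h2 := norm_nonneg z
  have h3 : 0 < 1 - ‖z‖ := by linarith
  have h4 : 0 < ‖circleMap 0 1 x - z‖ := by linarith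
  rw [div_le_div_iff₀ (by positivity) h3]
  have : (1 - ‖z‖) ^ 2 ≤ ‖circleMap 0 1 x - z‖ ^ 2 := by gcongr
  nlinarith

lemma norm_circleMap_sub_le (x y : ℝ) : ‖circleMap 0 1 x - circleMap 0 1 y‖ ≤ |x - y| := by
  have := (lipschitzWith_circleMap 0 1).dist_le_mul x y
  simpa [dist_eq_norm] using this

/-- A quantitative Harnack inequality for the Poisson kernel. -/
lemma diskKernel_le_mul {z : ℂ} (hz : ‖z‖ < 1) {x y l : ℝ} (hxy : |x - y| ≤ l)
    (hl : l ≤ 1 - ‖z‖) :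
    diskKernel z x ≤ (1 + 3 * l / (1 - ‖z‖)) * diskKernel z y := by
  have h3 : 0 < 1 - ‖z‖ := by linarith
  have hx := one_sub_norm_le_norm_circleMap_sub z x
  have hy := one_sub_norm_le_norm_circleMap_sub z y
  have hl0 : 0 ≤ l := (abs_nonneg _).trans hxy
  have htri : ‖circleMap 0 1 y - z‖ ≤ ‖circleMap 0 1 x - z‖ + l := by
    have h4 := norm_sub_le_norm_sub_add_norm_sub (circleMap 0 1 y) (circleMap 0 1 x) z
    have h5 := norm_circleMap_sub_le y x
    rw [abs_sub_comm] at h5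
    linarith
  have hpos := diskKernel_pos hz y
  rw [diskKernel_eq, diskKernel_eq]
  set a := ‖circleMap 0 1 x - z‖
  set b := ‖circleMap 0 1 y - z‖
  set d := 1 - ‖z‖
  have ha : 0 < a := by linarith
  have hb : 0 < b := by linarith
  have hn : 0 ≤ 1 - ‖z‖ ^ 2 := by
    have := norm_nonneg z
    nlinarith
  have hr : 0 ≤ l / d := by positivity
  have hr1 : l / d ≤ 1 := by rw [div_le_one h3]; exact hl
  have hla : l ≤ l / d * a := by
    rw [div_mul_eq_mul_div, le_div_iff₀ h3]
    gcongr
  have hba : b ≤ (1 + l / d) * a := by linarith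
  have hsq : b ^ 2 ≤ (1 + 3 * l / d) * a ^ 2 := by
    calc b ^ 2 ≤ ((1 + l / d) * a) ^ 2 := by gcongr
      _ = (1 + l / d) ^ 2 * a ^ 2 := by ring
      _ ≤ (1 + 3 * l / d) * a ^ 2 := by
        gcongr
        have : 3 * l / d = 3 * (l / d) := by ring
        rw [this]; nlinarith
  rw [← mul_div_assoc, div_le_div_iff₀ (by positivity) (by positivity)]
  calc (1 - ‖z‖ ^ 2) * b ^ 2 ≤ (1 - ‖z‖ ^ 2) * ((1 + 3 * l / d) * a ^ 2) := by gcongr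
    _ = _ := by ring

/-- The Poisson formula for the real part of a polynomial. -/
lemma re_eval_eq_integral (Q : Polynomial ℂ) {z : ℂ} (hz : ‖z‖ < 1) :
    (Q.eval z).re = (2 * Real.pi)⁻¹ *
      ∫ x in Ioc 0 (2 * Real.pi), diskKernel z x * (Q.eval (circleMap 0 1 x)).re := by
  have hd : DiffContOnCl ℂ (fun z => Q.eval z) (Metric.ball 0 1) :=
    Q.differentiable.diffContOnCl
  have h := hd.circleAverage_poissonKernel_smul (w := z) (by simpa using hz)
  rw [Real.circleAverage_def, intervalIntegral.integral_of_le (by positivity)] at h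
  rw [← h]
  have hinteg : IntegrableOn (fun x => (poissonKernel 0 z • fun z => Q.eval z) (circleMap 0 1 x))
      (Ioc 0 (2 * Real.pi)) := by
    have hc : Continuous fun x : ℝ => (diskKernel z x : ℂ) * Q.eval (circleMap 0 1 x) := by
      have := continuous_diskKernel hz
      fun_prop
    have := hc.integrableOn_Ioc (μ := volume) (a := 0) (b := 2 * Real.pi)
    refine this.congr_fun (fun x _ => ?_) measurableSet_Ioc
    simp [diskKernel]
  have h2 := (RCLike.reCLM (K := ℂ)).integral_comp_comm hinteg
  simp only [Complex.smul_re, smul_eq_mul]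
  congr 1
  rw [show ∀ w : ℂ, w.re = RCLike.reCLM (K := ℂ) w from fun w => rfl, ← h2]
  refine setIntegral_congr_fun measurableSet_Ioc (fun x _ => ?_)
  simp [diskKernel]

lemma integral_diskKernel {z : ℂ} (hz : ‖z‖ < 1) :
    ∫ x in Ioc 0 (2 * Real.pi), diskKernel z x = 2 * Real.pi := by
  have h := re_eval_eq_integral 1 hz
  simp only [Polynomial.eval_one, Complex.one_re, mul_one] at h
  have : (2 * Real.pi) ≠ 0 := by positivity
  field_simp at h
  linarith

/-- On an arc of length `l ≤ 1 - ‖z‖`, a nonnegative mass `H` integrates against the Poisson kernel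
to at most the average of the kernel, up to the oscillation factor. -/
lemma setIntegral_diskKernel_mul_le {z : ℂ} (hz : ‖z‖ < 1) {a b H : ℝ} {ρ : ℝ → ℝ} (hab : a < b)
    (hl : b - a ≤ 1 - ‖z‖) (hρ : IntegrableOn ρ (Ioc a b)) (hρ0 : ∀ x, 0 ≤ ρ x)
    (hH : ∫ x in Ioc a b, ρ x ≤ H) :
    ∫ x in Ioc a b, diskKernel z x * ρ x ≤
      (1 + 3 * (b - a) / (1 - ‖z‖)) * (H / (b - a)) * ∫ x in Ioc a b, diskKernel z x := by
  have h3 : 0 < 1 - ‖z‖ := by linarith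
  have hba : 0 < b - a := by linarith
  set θ := 1 + 3 * (b - a) / (1 - ‖z‖)
  have hθ : 0 ≤ θ := by positivity
  set A := ∫ x in Ioc a b, diskKernel z x
  have hKint : IntegrableOn (diskKernel z) (Ioc a b) :=
    (continuous_diskKernel hz).integrableOn_Ioc
  have hA : 0 ≤ A := integral_nonneg (fun x => (diskKernel_pos hz x).le)
  have hpt : ∀ x ∈ Ioc a b, diskKernel z x ≤ θ * (A / (b - a)) := by
    intro x hx
    have h1 : ∫ y in Ioc a b, diskKernel z x ≤ ∫ y in Ioc a b, θ * diskKernel z y := by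
      refine setIntegral_mono_on (by simp) (hKint.const_mul θ) measurableSet_Ioc ?_
      intro y hy
      refine diskKernel_le_mul hz ?_ hl
      rw [abs_le]
      constructor <;> linarith [hx.1, hx.2, hy.1, hy.2]
    rw [integral_const_mul] at h1
    simp only [integral_const, smul_eq_mul] at h1
    rw [measureReal_restrict_apply_univ, Real.volume_real_Ioc_of_le hab.le] at h1
    rw [← mul_div_assoc, le_div_iff₀ hba]
    linarith
  have hprod : IntegrableOn (fun x => diskKernel z x * ρ x) (Ioc a b) := by
    refine Integrable.bdd_mul (c := 2 / (1 - ‖z‖)) hρ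
      (continuous_diskKernel hz).aestronglyMeasurable ?_
    filter_upwards with x
    rw [Real.norm_of_nonneg (diskKernel_pos hz x).le]
    exact diskKernel_le hz x
  calc ∫ x in Ioc a b, diskKernel z x * ρ x
      ≤ ∫ x in Ioc a b, θ * (A / (b - a)) * ρ x := by
        refine setIntegral_mono_on hprod (hρ.const_mul _) measurableSet_Ioc ?_
        intro x hx
        exact mul_le_mul_of_nonneg_right (hpt x hx) (hρ0 x)
    _ = θ * (A / (b - a)) * ∫ x in Ioc a b, ρ x := integral_const_mul _ _
    _ ≤ θ * (A / (b - a)) * H := by gcongr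
    _ = θ * (H / (b - a)) * A := by ring

/-- The length of the dyadic intervals of generation `k` in `(0, 2π]`. -/
def dyadLength (k : ℕ) : ℝ := 2 * Real.pi / 2 ^ k

/-- The `j`-th half-open dyadic interval of generation `k`. -/
def dyad (k j : ℕ) : Set ℝ := Ioc (dyadLength k * j) (dyadLength k * (j + 1))

lemma dyadLength_pos (k : ℕ) : 0 < dyadLength k := by
  unfold dyadLength; positivity

lemma dyadLength_eq_two_mul (k : ℕ) : dyadLength k = 2 * dyadLength (k + 1) := by
  unfold dyadLength; field_simp; ring

lemma dyadLength_antitone : Antitone dyadLength :=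
  antitone_nat_of_succ_le fun k => by
    linarith [dyadLength_eq_two_mul k, dyadLength_pos (k + 1)]

lemma dyadLength_strictAnti : StrictAnti dyadLength :=
  strictAnti_nat_of_succ_lt fun k => by
    linarith [dyadLength_eq_two_mul k, dyadLength_pos (k + 1)]

lemma tendsto_dyadLength : Tendsto dyadLength atTop (𝓝[>] 0) := by
  rw [tendsto_nhdsWithin_iff]
  refine ⟨?_, Eventually.of_forall dyadLength_pos⟩
  have : Tendsto (fun k : ℕ => 2 * Real.pi * (1 / 2) ^ k) atTop (𝓝 (2 * Real.pi * 0)) :=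
    (tendsto_pow_atTop_nhds_zero_of_lt_one (by norm_num) (by norm_num)).const_mul _
  rw [mul_zero] at this
  refine this.congr fun k => ?_
  simp [dyadLength, div_eq_mul_inv]

lemma dyad_zero : dyad 0 0 = Ioc 0 (2 * Real.pi) := by
  simp [dyad, dyadLength]

lemma measurableSet_dyad (k j : ℕ) : MeasurableSet (dyad k j) := measurableSet_Ioc

lemma volume_real_dyad (k j : ℕ) : volume.real (dyad k j) = dyadLength k := by
  have := dyadLength_pos k
  rw [dyad, Real.volume_real_Ioc_of_le (by nlinarith)]
  ring

lemma volume_dyad_ne_top (k j : ℕ) : volume (dyad k j) ≠ ⊤ := by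
  simp [dyad]

lemma dyad_nonempty (k j : ℕ) : (dyad k j).Nonempty := by
  have := dyadLength_pos k
  exact nonempty_Ioc.2 (by nlinarith)

lemma dyad_eq_union (k j : ℕ) : dyad k j = dyad (k + 1) (2 * j) ∪ dyad (k + 1) (2 * j + 1) := by
  have := dyadLength_pos (k + 1)
  unfold dyad
  rw [dyadLength_eq_two_mul k]
  push_cast
  have e1 : dyadLength (k + 1) * (2 * (j : ℝ) + 1 + 1) = 2 * dyadLength (k + 1) * (j + 1) := by ring
  have e2 : dyadLength (k + 1) * (2 * (j : ℝ)) = 2 * dyadLength (k + 1) * j := by ring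
  rw [Ioc_union_Ioc_eq_Ioc (by nlinarith) (by nlinarith), e1, e2]

lemma dyad_disjoint (k : ℕ) {i j : ℕ} (hij : i ≠ j) : Disjoint (dyad k i) (dyad k j) := by
  have hpos := dyadLength_pos k
  have key : ∀ {i j : ℕ}, i < j → Disjoint (dyad k i) (dyad k j) := by
    intro i j h
    rw [Set.disjoint_left]
    intro x hx hx'
    have h1 : (i : ℝ) + 1 ≤ j := by exact_mod_cast h
    have h2 : dyadLength k * (i + 1) ≤ dyadLength k * j := by gcongr
    linarith [hx.2, hx'.1]
  rcases lt_or_gt_of_ne hij with h | h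
  · exact key h
  · exact (key h).symm

lemma dyad_child_disjoint (k j : ℕ) :
    Disjoint (dyad (k + 1) (2 * j)) (dyad (k + 1) (2 * j + 1)) :=
  dyad_disjoint _ (by omega)

lemma dyad_succ_subset (k j : ℕ) : dyad (k + 1) j ⊆ dyad k (j / 2) := by
  rw [dyad_eq_union k]
  rcases Nat.even_or_odd' j with ⟨i, rfl | rfl⟩
  · simp
  · rw [show (2 * i + 1) / 2 = i by omega]
    exact subset_union_right

lemma exists_dyad_superset {k k' : ℕ} (h : k ≤ k') (j' : ℕ) : ∃ j, dyad k' j' ⊆ dyad k j := by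
  induction k', h using Nat.le_induction generalizing j' with
  | base => exact ⟨j', Subset.rfl⟩
  | succ k' h ih =>
    obtain ⟨j, hj⟩ := ih (j' / 2)
    exact ⟨j, (dyad_succ_subset k' j').trans hj⟩

lemma dyad_subset_of_inter {k k' j j' : ℕ} (h : k ≤ k') {x : ℝ} (hx : x ∈ dyad k j)
    (hx' : x ∈ dyad k' j') : dyad k' j' ⊆ dyad k j := by
  obtain ⟨i, hi⟩ := exists_dyad_superset h j'
  have : i = j := by
    by_contra hne
    exact Set.disjoint_left.1 (dyad_disjoint k hne) (hi hx') hx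
  exact this ▸ hi

lemma le_of_dyad_subset {k k' j j' : ℕ} (h : dyad k' j' ⊆ dyad k j) : k ≤ k' := by
  have h1 := measureReal_mono h (volume_dyad_ne_top k j)
  rw [volume_real_dyad, volume_real_dyad] at h1
  exact dyadLength_strictAnti.le_iff_ge.1 h1

lemma setIntegral_dyad_eq_add {f : ℝ → ℝ} {k j : ℕ} (hf : IntegrableOn f (dyad k j)) :
    ∫ x in dyad k j, f x =
      (∫ x in dyad (k + 1) (2 * j), f x) + ∫ x in dyad (k + 1) (2 * j + 1), f x := by
  rw [dyad_eq_union] at hf ⊢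
  exact setIntegral_union (dyad_child_disjoint k j) (measurableSet_dyad _ _) hf.left_of_union
    hf.right_of_union

/-- An additive upper bound on the dyadic subintervals of one generation holds for the whole. -/
lemma setIntegral_dyad_le_of_le {f g : ℝ → ℝ} {k j : ℕ} (m : ℕ)
    (hf : IntegrableOn f (dyad k j)) (hg : IntegrableOn g (dyad k j))
    (h : ∀ i, dyad (k + m) i ⊆ dyad k j →
      ∫ x in dyad (k + m) i, f x ≤ ∫ x in dyad (k + m) i, g x) :
    ∫ x in dyad k j, f x ≤ ∫ x in dyad k j, g x := by
  induction m generalizing k j with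
  | zero => exact h j Subset.rfl
  | succ m ih =>
    have hl : dyad (k + 1) (2 * j) ⊆ dyad k j := by rw [dyad_eq_union k j]; exact subset_union_left
    have hr : dyad (k + 1) (2 * j + 1) ⊆ dyad k j := by
      rw [dyad_eq_union k j]; exact subset_union_right
    rw [setIntegral_dyad_eq_add hf, setIntegral_dyad_eq_add hg]
    rw [← add_assoc, add_right_comm] at h
    exact add_le_add (ih (hf.mono_set hl) (hg.mono_set hl) fun i hi => h i (hi.trans hl))
      (ih (hf.mono_set hr) (hg.mono_set hr) fun i hi => h i (hi.trans hr))

lemma IsGauge.nonneg {h : ℝ → ℝ} (hg : IsGauge h) {x : ℝ} (hx : 0 ≤ x) : 0 ≤ h x := by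
  have := hg.mono (mem_Ici.2 le_rfl) (mem_Ici.2 hx) hx
  rwa [hg.zero] at this

lemma IsGauge.pos {h : ℝ → ℝ} (hg : IsGauge h) {x : ℝ} (hx : 0 < x) : 0 < h x := by
  have h1 := hg.r2.eventually_ge_atTop 1
  have h2 : ∀ᶠ y in 𝓝[>] (0 : ℝ), y ∈ Ioo 0 x := Ioo_mem_nhdsGT hx
  obtain ⟨y, hy1, hy2⟩ := (h1.and h2).exists
  rw [le_div_iff₀ hy2.1] at hy1
  have := hg.mono (mem_Ici.2 hy2.1.le) (mem_Ici.2 hx.le) hy2.2.le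
  linarith [hy2.1]

lemma IsGauge.tendsto_dyadLength {h : ℝ → ℝ} (hg : IsGauge h) :
    Tendsto (fun n => h (dyadLength n)) atTop (𝓝 0) := by
  have h1 : Tendsto h (𝓝[≥] 0) (𝓝 (h 0)) := hg.continuousOn 0 (mem_Ici.2 le_rfl)
  rw [hg.zero] at h1
  exact h1.comp (_root_.tendsto_dyadLength.mono_right (nhdsWithin_mono _ Ioi_subset_Ici_self))

/-- A mass distribution `ρ` admissible for the dyadic interval `dyad k j`: it is bounded by
`log⁺ (1 / W)`, and each dyadic subinterval of length `l` carries at most the mass `h l`. -/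
structure IsFlow (h W : ℝ → ℝ) (k j : ℕ) (ρ : ℝ → ℝ) : Prop where
  measurable : Measurable ρ
  nonneg : ∀ x, 0 ≤ ρ x
  bounded : ∃ M, ∀ x, ρ x ≤ M
  mul_exp_le : ∀ x, W x * Real.exp (ρ x) ≤ max 1 (W x)
  mass_le : ∀ k' j', dyad k' j' ⊆ dyad k j → ∫ x in dyad k' j', ρ x ≤ h (dyadLength k')

/-- A dyadic interval is saturated if it carries an admissible distribution of full mass. -/
def IsSaturated (h W : ℝ → ℝ) (k j : ℕ) : Prop :=
  ∃ ρ, IsFlow h W k j ρ ∧ ∫ x in dyad k j, ρ x = h (dyadLength k)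

lemma integrableOn_of_bounded {ρ : ℝ → ℝ} (hm : Measurable ρ) {M : ℝ} (hM : ∀ x, |ρ x| ≤ M)
    {s : Set ℝ} (hs : volume s ≠ ⊤) : IntegrableOn ρ s :=
  Measure.integrableOn_of_bounded (M := M) hs hm.aestronglyMeasurable
    (Eventually.of_forall fun x => by simpa using hM x)

lemma IsFlow.integrableOn {h W ρ : ℝ → ℝ} {k j : ℕ} (hρ : IsFlow h W k j ρ) {s : Set ℝ}
    (hs : volume s ≠ ⊤) : IntegrableOn ρ s := by
  obtain ⟨M, hM⟩ := hρ.bounded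
  refine integrableOn_of_bounded hρ.measurable (M := M) (fun x => ?_) hs
  rw [abs_of_nonneg (hρ.nonneg x)]
  exact hM x

/-- The maximal saturated dyadic intervals among those of generation at least `n`. -/
def maximalSaturated (h W : ℝ → ℝ) (n : ℕ) : Set (ℕ × ℕ) :=
  {I | n ≤ I.1 ∧ IsSaturated h W I.1 I.2 ∧
    ∀ k' j', n ≤ k' → IsSaturated h W k' j' → dyad I.1 I.2 ⊆ dyad k' j' → k' = I.1}

lemma exists_maximalSaturated_superset {h W : ℝ → ℝ} {n k j : ℕ} (hk : n ≤ k)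
    (hs : IsSaturated h W k j) :
    ∃ I ∈ maximalSaturated h W n, dyad k j ⊆ dyad I.1 I.2 := by
  classical
  have hex : ∃ k', n ≤ k' ∧ ∃ j', IsSaturated h W k' j' ∧ dyad k j ⊆ dyad k' j' :=
    ⟨k, hk, j, hs, Subset.rfl⟩
  obtain ⟨h1, j', h2, h3⟩ := Nat.find_spec hex
  refine ⟨(Nat.find hex, j'), ⟨h1, h2, fun k'' j'' hn hs' hsub => ?_⟩, h3⟩
  exact le_antisymm (le_of_dyad_subset hsub) (Nat.find_min' hex ⟨hn, j'', hs', h3.trans hsub⟩)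

lemma maximalSaturated_disjoint {h W : ℝ → ℝ} {n : ℕ} {I J : ℕ × ℕ}
    (hI : I ∈ maximalSaturated h W n) (hJ : J ∈ maximalSaturated h W n) (hne : I ≠ J) :
    Disjoint (dyad I.1 I.2) (dyad J.1 J.2) := by
  have key : ∀ {I J : ℕ × ℕ}, I ∈ maximalSaturated h W n → J ∈ maximalSaturated h W n → I ≠ J →
      I.1 ≤ J.1 → Disjoint (dyad I.1 I.2) (dyad J.1 J.2) := by
    intro I J hI hJ hne hle
    rw [Set.disjoint_left]
    intro x hx hx'
    have hsub := dyad_subset_of_inter hle hx hx'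
    have h1 := hJ.2.2 _ _ hI.1 hI.2.1 hsub
    apply hne
    refine Prod.ext h1 ?_
    by_contra h2
    rw [h1] at hx
    exact Set.disjoint_left.1 (dyad_disjoint J.1 h2) hx hx'
  rcases le_total I.1 J.1 with h | h
  · exact key hI hJ hne h
  · exact (key hJ hI hne.symm h).symm

/-- The points lying in no saturated dyadic interval of generation at least `n`. -/
def unsaturatedSet (h W : ℝ → ℝ) (n : ℕ) : Set ℝ :=
  (⋃ I ∈ maximalSaturated h W n, dyad I.1 I.2)ᶜ

lemma measurableSet_unsaturatedSet (h W : ℝ → ℝ) (n : ℕ) :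
    MeasurableSet (unsaturatedSet h W n) :=
  (MeasurableSet.biUnion (to_countable _) fun I _ => measurableSet_dyad I.1 I.2).compl

/-- The truncation `min (log⁺ (1 / W)) M`. -/
def truncLog (W : ℝ → ℝ) (M : ℕ) (x : ℝ) : ℝ := (min (nlog (W x)) M).toReal

lemma measurable_nlog : Measurable nlog := by
  unfold nlog
  refine Measurable.ite (measurableSet_singleton 0) measurable_const ?_
  exact (Real.measurable_log.comp measurable_inv).ennreal_ofReal

lemma measurable_truncLog {W : ℝ → ℝ} (hW : Measurable W) (M : ℕ) : Measurable (truncLog W M) :=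
  ((measurable_nlog.comp hW).min measurable_const).ennreal_toReal

lemma truncLog_nonneg (W : ℝ → ℝ) (M : ℕ) (x : ℝ) : 0 ≤ truncLog W M x := ENNReal.toReal_nonneg

lemma min_nlog_ne_top (M : ℕ) (r : ℝ) : min (nlog r) M ≠ ⊤ :=
  ne_top_of_le_ne_top (ENNReal.natCast_ne_top M) (min_le_right _ _)

lemma truncLog_le (W : ℝ → ℝ) (M : ℕ) (x : ℝ) : truncLog W M x ≤ M := by
  have h1 := ENNReal.toReal_mono (ENNReal.natCast_ne_top M) (min_le_right (nlog (W x)) M)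
  rwa [ENNReal.toReal_natCast] at h1

lemma mul_exp_truncLog_le {W : ℝ → ℝ} (hW : ∀ x, 0 ≤ W x) (M : ℕ) (x : ℝ) :
    W x * Real.exp (truncLog W M x) ≤ max 1 (W x) := by
  rcases (hW x).eq_or_lt with h0 | h0
  · rw [← h0]; simp
  · have hn : nlog (W x) = ENNReal.ofReal (Real.log (W x)⁻¹) := by simp [nlog, h0.ne']
    have h1 : truncLog W M x ≤ max (Real.log (W x)⁻¹) 0 := by
      have := ENNReal.toReal_mono (b := ENNReal.ofReal (Real.log (W x)⁻¹)) ENNReal.ofReal_ne_top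
        (hn ▸ min_le_left (nlog (W x)) (M : ENNReal))
      rw [ENNReal.toReal_ofReal'] at this
      rwa [truncLog, hn]
    calc W x * Real.exp (truncLog W M x) ≤ W x * Real.exp (max (Real.log (W x)⁻¹) 0) := by gcongr
      _ ≤ max 1 (W x) := by
        rcases le_total (Real.log (W x)⁻¹) 0 with h2 | h2
        · rw [max_eq_right h2, Real.exp_zero, mul_one]
          exact le_max_right _ _
        · rw [max_eq_left h2, Real.exp_log (by positivity), mul_inv_cancel₀ h0.ne']
          exact le_max_left _ _

/-- The superposition of distributions on the intervals of `F` with the truncated logarithm on the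
unsaturated set. -/
def totalFlow (h W : ℝ → ℝ) (n M : ℕ) (F : Finset (ℕ × ℕ)) (ρ : ℕ × ℕ → ℝ → ℝ) (x : ℝ) : ℝ :=
  ∑ I ∈ F, (dyad I.1 I.2).indicator (ρ I) x + (unsaturatedSet h W n).indicator (truncLog W M) x

section totalFlow

variable {h W : ℝ → ℝ} {n M : ℕ} {F : Finset (ℕ × ℕ)} {ρ : ℕ × ℕ → ℝ → ℝ}

lemma sum_indicator_eq_of_mem (hF : ∀ I ∈ F, I ∈ maximalSaturated h W n) {I : ℕ × ℕ} (hI : I ∈ F)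
    (ρ : ℕ × ℕ → ℝ → ℝ) {x : ℝ} (hx : x ∈ dyad I.1 I.2) :
    ∑ J ∈ F, (dyad J.1 J.2).indicator (ρ J) x = ρ I x := by
  rw [Finset.sum_eq_single_of_mem I hI, indicator_of_mem hx]
  intro J hJ hne
  refine indicator_of_notMem (fun hx' => ?_) _
  exact Set.disjoint_left.1 (maximalSaturated_disjoint (hF J hJ) (hF I hI) hne) hx' hx

lemma totalFlow_of_mem (hF : ∀ I ∈ F, I ∈ maximalSaturated h W n) {I : ℕ × ℕ} (hI : I ∈ F)
    {x : ℝ} (hx : x ∈ dyad I.1 I.2) : totalFlow h W n M F ρ x = ρ I x := by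
  rw [totalFlow, sum_indicator_eq_of_mem hF hI ρ hx, indicator_of_notMem, add_zero]
  intro hx'
  exact hx' (mem_biUnion (hF I hI) hx)

lemma totalFlow_of_mem_of_notMem (hF : ∀ I ∈ F, I ∈ maximalSaturated h W n) {I : ℕ × ℕ}
    (hI : I ∈ maximalSaturated h W n) (hIF : I ∉ F) {x : ℝ} (hx : x ∈ dyad I.1 I.2) :
    totalFlow h W n M F ρ x = 0 := by
  rw [totalFlow, indicator_of_notMem, add_zero]
  · refine Finset.sum_eq_zero fun J hJ => indicator_of_notMem (fun hx' => ?_) _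
    have hne : J ≠ I := fun h => hIF (h ▸ hJ)
    exact Set.disjoint_left.1 (maximalSaturated_disjoint (hF J hJ) hI hne) hx' hx
  · intro hx'
    exact hx' (mem_biUnion hI hx)

lemma totalFlow_of_mem_unsaturatedSet (hF : ∀ I ∈ F, I ∈ maximalSaturated h W n) {x : ℝ}
    (hx : x ∈ unsaturatedSet h W n) : totalFlow h W n M F ρ x = truncLog W M x := by
  rw [totalFlow, indicator_of_mem hx, Finset.sum_eq_zero, zero_add]
  intro J hJ
  exact indicator_of_notMem (fun hx' => hx (mem_biUnion (hF J hJ) hx')) _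

/-- Pointwise properties of `totalFlow` follow from those of its pieces. -/
lemma totalFlow_induction (hF : ∀ I ∈ F, I ∈ maximalSaturated h W n) {p : ℝ → ℝ → Prop} (x : ℝ)
    (h₁ : ∀ I ∈ F, p x (ρ I x)) (h₂ : p x 0) (h₃ : p x (truncLog W M x)) :
    p x (totalFlow h W n M F ρ x) := by
  by_cases hx : x ∈ unsaturatedSet h W n
  · rwa [totalFlow_of_mem_unsaturatedSet hF hx]
  · simp only [unsaturatedSet, mem_compl_iff, not_not, mem_iUnion] at hx
    obtain ⟨I, hI, hxI⟩ := hx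
    by_cases hIF : I ∈ F
    · rw [totalFlow_of_mem hF hIF hxI]
      exact h₁ I hIF
    · rwa [totalFlow_of_mem_of_notMem hF hI hIF hxI]

lemma measurable_totalFlow (hW : Measurable W) (hρ : ∀ I ∈ F, Measurable (ρ I)) :
    Measurable (totalFlow h W n M F ρ) := by
  unfold totalFlow
  refine Measurable.add (Finset.measurable_sum _ fun I hI => ?_) ?_
  · exact (hρ I hI).indicator (measurableSet_dyad _ _)
  · exact (measurable_truncLog hW M).indicator (measurableSet_unsaturatedSet h W n)

lemma exists_totalFlow_le (hF : ∀ I ∈ F, I ∈ maximalSaturated h W n)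
    (hρ : ∀ I ∈ F, IsFlow h W I.1 I.2 (ρ I)) : ∃ B, ∀ x, totalFlow h W n M F ρ x ≤ B := by
  choose! m hm using fun I hI => (hρ I hI).bounded
  refine ⟨∑ I ∈ F, |m I| + M, fun x => ?_⟩
  have hs : 0 ≤ ∑ I ∈ F, |m I| := Finset.sum_nonneg fun _ _ => abs_nonneg _
  refine totalFlow_induction (p := fun _ r => r ≤ ∑ I ∈ F, |m I| + M) hF x ?_ (by positivity) ?_
  · intro I hI
    have h1 := Finset.single_le_sum (f := fun I => |m I|) (fun _ _ => abs_nonneg _) hI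
    have h2 := hm I hI x
    have h3 := le_abs_self (m I)
    have h4 : (0 : ℝ) ≤ M := by positivity
    linarith
  · linarith [truncLog_le W M x]

/-- The superposition obeys the mass bounds of a flow on every dyadic interval of generation at
least `n`: an interval violating them would be saturated. -/
lemma setIntegral_totalFlow_le (hg : IsGauge h) (hW : Measurable W) (hW0 : ∀ x, 0 ≤ W x)
    (hF : ∀ I ∈ F, I ∈ maximalSaturated h W n) (hρ : ∀ I ∈ F, IsFlow h W I.1 I.2 (ρ I))
    {k : ℕ} (hk : n ≤ k) (j : ℕ) :
    ∫ x in dyad k j, totalFlow h W n M F ρ x ≤ h (dyadLength k) := by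
  set σ := totalFlow h W n M F ρ with hσ
  have hmeas : Measurable σ := measurable_totalFlow hW fun I hI => (hρ I hI).measurable
  obtain ⟨B, hB⟩ : ∃ B, ∀ x, σ x ≤ B := exists_totalFlow_le hF hρ
  have h0 : ∀ x, 0 ≤ σ x := fun x => totalFlow_induction (p := fun _ r => 0 ≤ r) hF x
    (fun I hI => (hρ I hI).nonneg x) le_rfl (truncLog_nonneg W M x)
  have hexp : ∀ x, W x * Real.exp (σ x) ≤ max 1 (W x) := fun x =>
    totalFlow_induction (p := fun x r => W x * Real.exp r ≤ max 1 (W x)) hF x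
      (fun I hI => (hρ I hI).mul_exp_le x) (by simp) (mul_exp_truncLog_le hW0 M x)
  have hinteg : ∀ k j, IntegrableOn σ (dyad k j) := fun k j =>
    integrableOn_of_bounded hmeas (M := B) (fun x => by rw [abs_of_nonneg (h0 x)]; exact hB x)
      (volume_dyad_ne_top k j)
  obtain ⟨k₀, hk₀⟩ : ∃ k₀, ∀ k, k₀ ≤ k → B ≤ h (dyadLength k) / dyadLength k :=
    eventually_atTop.1 ((hg.r2.comp tendsto_dyadLength).eventually_ge_atTop B)
  have hsmall : ∀ k, k₀ ≤ k → ∀ j, ∫ x in dyad k j, σ x ≤ h (dyadLength k) := by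
    intro k hk j
    have h1 : ∫ x in dyad k j, σ x ≤ ∫ x in dyad k j, B :=
      setIntegral_mono_on (hinteg k j) (integrableOn_const (volume_dyad_ne_top k j))
        (measurableSet_dyad k j) fun x _ => hB x
    have h2 := hk₀ k hk
    rw [le_div_iff₀ (dyadLength_pos k)] at h2
    rw [setIntegral_const, volume_real_dyad, smul_eq_mul] at h1
    linarith
  suffices H : ∀ d k, n ≤ k → k₀ ≤ k + d → ∀ j, ∫ x in dyad k j, σ x ≤ h (dyadLength k) from
    H k₀ k hk (Nat.le_add_left _ _) j
  intro d
  induction d with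
  | zero => exact fun k _ hk₀' => hsmall k hk₀'
  | succ d ih =>
    intro k hk hkd j
    by_cases hcov : ∃ I ∈ maximalSaturated h W n, dyad k j ⊆ dyad I.1 I.2
    · obtain ⟨I, hI, hsub⟩ := hcov
      by_cases hIF : I ∈ F
      · rw [setIntegral_congr_fun (g := ρ I) (measurableSet_dyad k j)
          fun x hx => totalFlow_of_mem hF hIF (hsub hx)]
        exact (hρ I hIF).mass_le k j hsub
      · rw [setIntegral_congr_fun (g := fun _ => (0 : ℝ)) (measurableSet_dyad k j)
          fun x hx => totalFlow_of_mem_of_notMem hF hI hIF (hsub hx)]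
        simpa using hg.nonneg (dyadLength_pos k).le
    · by_contra! hlt
      apply hcov
      refine exists_maximalSaturated_superset hk ?_
      have hpos : 0 < ∫ x in dyad k j, σ x := (hg.nonneg (dyadLength_pos k).le).trans_lt hlt
      set θ := h (dyadLength k) / ∫ x in dyad k j, σ x with hθ
      have hθ0 : 0 ≤ θ := div_nonneg (hg.nonneg (dyadLength_pos k).le) hpos.le
      have hθ1 : θ ≤ 1 := (div_le_one hpos).2 hlt.le
      have hle : ∀ x, θ * σ x ≤ σ x := fun x => mul_le_of_le_one_left (h0 x) hθ1
      have htop : ∫ x in dyad k j, θ * σ x = h (dyadLength k) := by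
        rw [integral_const_mul, hθ, div_mul_cancel₀ _ hpos.ne']
      refine ⟨fun x => θ * σ x, ⟨hmeas.const_mul θ, fun x => mul_nonneg hθ0 (h0 x),
        ⟨B, fun x => (hle x).trans (hB x)⟩, fun x => ?_, fun k' j' hsub => ?_⟩, htop⟩
      · refine le_trans ?_ (hexp x)
        exact mul_le_mul_of_nonneg_left (Real.exp_le_exp.2 (hle x)) (hW0 x)
      · rcases (le_of_dyad_subset hsub).eq_or_lt with heq | hlt'
        · subst heq
          have : j' = j := by
            by_contra hne
            obtain ⟨x, hx⟩ := dyad_nonempty k j'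
            exact Set.disjoint_left.1 (dyad_disjoint k hne) hx (hsub hx)
          rw [this, htop]
        · refine le_trans ?_ (ih k' (by omega) (by omega) j')
          exact setIntegral_mono_on ((hinteg k' j').const_mul θ) (hinteg k' j')
            (measurableSet_dyad k' j') fun x _ => hle x

/-- The min-cut bound: total capacity of maximal saturated intervals plus the integral over the
unsaturated set. -/
lemma sum_add_setIntegral_truncLog_le (hg : IsGauge h) (hW : Measurable W) (hW0 : ∀ x, 0 ≤ W x)
    (hF : ∀ I ∈ F, I ∈ maximalSaturated h W n)
    (hFs : ∀ I ∈ F, dyad I.1 I.2 ⊆ Ioc 0 (2 * Real.pi)) :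
    ∑ I ∈ F, h (dyadLength I.1) +
      ∫ x in Ioc 0 (2 * Real.pi) ∩ unsaturatedSet h W n, truncLog W M x ≤
        2 * Real.pi * (h (dyadLength n) / dyadLength n) := by
  choose! ρ hρ hρm using fun I (hI : I ∈ F) => (hF I hI).2.1
  have hfin : volume (Ioc 0 (2 * Real.pi)) ≠ ⊤ := dyad_zero ▸ volume_dyad_ne_top 0 0
  have hti : ∀ s, volume s ≠ ⊤ → IntegrableOn (truncLog W M) s := fun s hs =>
    integrableOn_of_bounded (measurable_truncLog hW M) (M := M)
      (fun x => by rw [abs_of_nonneg (truncLog_nonneg W M x)]; exact truncLog_le W M x) hs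
  have hσ : ∫ x in Ioc 0 (2 * Real.pi), totalFlow h W n M F ρ x =
      ∑ I ∈ F, h (dyadLength I.1) +
        ∫ x in Ioc 0 (2 * Real.pi) ∩ unsaturatedSet h W n, truncLog W M x := by
    unfold totalFlow
    have hi : ∀ I ∈ F, IntegrableOn ((dyad I.1 I.2).indicator (ρ I)) (Ioc 0 (2 * Real.pi)) :=
      fun I hI => ((hρ I hI).integrableOn hfin).indicator (measurableSet_dyad _ _)
    rw [integral_add (integrable_finsetSum _ hi)
      ((hti _ hfin).indicator (measurableSet_unsaturatedSet h W n)),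
      integral_finsetSum _ hi, setIntegral_indicator (measurableSet_unsaturatedSet h W n)]
    congr 1
    refine Finset.sum_congr rfl fun I hI => ?_
    rw [setIntegral_indicator (measurableSet_dyad _ _), inter_eq_right.2 (hFs I hI), hρm I hI]
  rw [← hσ, ← dyad_zero]
  have hσi : IntegrableOn (totalFlow h W n M F ρ) (dyad 0 0) := by
    obtain ⟨B, hB⟩ := exists_totalFlow_le (M := M) hF hρ
    refine integrableOn_of_bounded (measurable_totalFlow hW fun I hI => (hρ I hI).measurable)
      (M := B) (fun x => ?_) (volume_dyad_ne_top 0 0)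
    rw [abs_of_nonneg]
    · exact hB x
    · exact totalFlow_induction (p := fun _ r => 0 ≤ r) hF x
        (fun I hI => (hρ I hI).nonneg x) le_rfl (truncLog_nonneg W M x)
  have h1 := setIntegral_dyad_le_of_le (g := fun _ => h (dyadLength n) / dyadLength n) n hσi
    (integrableOn_const (volume_dyad_ne_top 0 0)) fun i _ => by
      rw [setIntegral_const, volume_real_dyad, zero_add, smul_eq_mul,
        mul_div_cancel₀ _ (dyadLength_pos n).ne']
      exact setIntegral_totalFlow_le hg hW hW0 hF hρ le_rfl i
  rw [setIntegral_const, volume_real_dyad, smul_eq_mul] at h1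
  simpa [dyadLength] using h1

end totalFlow

lemma iSup_min_natCast (a : ENNReal) : ⨆ M : ℕ, min a (M : ENNReal) = a := by
  rw [← inf_iSup_eq, ENNReal.iSup_natCast, inf_top_eq]

/-- The integral of `log⁺ (1 / W)` over the unsaturated set is finite. -/
lemma setLIntegral_nlog_unsaturatedSet_lt_top {h W : ℝ → ℝ} (hg : IsGauge h) (hW : Measurable W)
    (hW0 : ∀ x, 0 ≤ W x) (n : ℕ) :
    ∫⁻ x in Ioc 0 (2 * Real.pi) ∩ unsaturatedSet h W n, nlog (W x) < ⊤ := by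
  set s := Ioc 0 (2 * Real.pi) ∩ unsaturatedSet h W n
  have hs : volume s ≠ ⊤ := by
    refine ne_top_of_le_ne_top ?_ (measure_mono inter_subset_left)
    exact dyad_zero ▸ volume_dyad_ne_top 0 0
  have h1 : ∀ x, nlog (W x) = ⨆ M : ℕ, min (nlog (W x)) (M : ENNReal) := fun x =>
    (iSup_min_natCast _).symm
  have hm : ∀ M : ℕ, Measurable fun x => min (nlog (W x)) (M : ENNReal) := fun M =>
    (measurable_nlog.comp hW).min measurable_const
  rw [lintegral_congr h1, lintegral_iSup hm
    fun M M' hMM' x => min_le_min_left _ (by exact_mod_cast hMM')]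
  refine lt_of_le_of_lt (iSup_le fun M => ?_)
    (ENNReal.ofReal_lt_top (r := 2 * Real.pi * (h (dyadLength n) / dyadLength n)))
  have h2 : ∀ x, min (nlog (W x)) (M : ENNReal) = ENNReal.ofReal (truncLog W M x) := fun x =>
    (ENNReal.ofReal_toReal (min_nlog_ne_top M _)).symm
  rw [lintegral_congr h2]
  rw [← ofReal_integral_eq_lintegral_ofReal]
  · refine ENNReal.ofReal_le_ofReal ?_
    simpa using sum_add_setIntegral_truncLog_le (F := ∅) (M := M) (n := n) hg hW hW0
      (by simp) (by simp)
  · exact integrableOn_of_bounded (measurable_truncLog hW M) (M := M)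
      (fun x => by rw [abs_of_nonneg (truncLog_nonneg W M x)]; exact truncLog_le W M x) hs
  · exact Eventually.of_forall fun x => truncLog_nonneg W M x

lemma coe_injOn_Ioc : InjOn (fun x : ℝ => (x : UnitCircle)) (Ioc 0 (2 * Real.pi)) := by
  intro x hx y hy hxy
  have e : (0 : ℝ) + 2 * Real.pi = 2 * Real.pi := zero_add _
  have h1 := AddCircle.equivIoc_coe_eq (p := 2 * Real.pi) (a := 0) (x := x) (by rwa [e])
  have h2 := AddCircle.equivIoc_coe_eq (p := 2 * Real.pi) (a := 0) (x := y) (by rwa [e])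
  have hxy' : (x : UnitCircle) = (y : UnitCircle) := hxy
  rw [hxy', h2] at h1
  exact (congrArg Subtype.val h1).symm

lemma volume_eq_volume_preimage_inter {U : Set UnitCircle} (hU : MeasurableSet U) :
    volume U = volume ((fun x : ℝ => (x : UnitCircle)) ⁻¹' U ∩ Ioc 0 (2 * Real.pi)) := by
  have := AddCircle.add_projection_respects_measure (2 * Real.pi) 0 hU
  rwa [zero_add] at this

lemma lintegral_circle_eq (f : UnitCircle → ENNReal) :
    ∫⁻ ζ, f ζ = ∫⁻ x in Ioc 0 (2 * Real.pi), f x := by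
  have := AddCircle.lintegral_preimage (2 * Real.pi) 0 f
  rwa [zero_add, eq_comm] at this

lemma setLIntegral_circle_eq {E : Set UnitCircle} (hE : MeasurableSet E) (f : UnitCircle → ENNReal) :
    ∫⁻ ζ in E, f ζ =
      ∫⁻ x in Ioc 0 (2 * Real.pi) ∩ (fun x : ℝ => (x : UnitCircle)) ⁻¹' E, f x := by
  have hm : Measurable fun x : ℝ => (x : UnitCircle) := AddCircle.measurable_mk'
  rw [← lintegral_indicator hE, lintegral_circle_eq]
  have : ∀ x : ℝ, E.indicator f (x : UnitCircle) =
      ((fun x : ℝ => (x : UnitCircle)) ⁻¹' E).indicator (fun x : ℝ => f x) x := fun x => rfl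
  simp_rw [this]
  rw [setLIntegral_indicator (hm hE), inter_comm]

/-- The open arc whose endpoints are those of a dyadic interval. -/
def dyadArc (I : ℕ × ℕ) : Set UnitCircle :=
  (fun x : ℝ => (x : UnitCircle)) '' Ioo (dyadLength I.1 * I.2) (dyadLength I.1 * (I.2 + 1))

lemma isOpen_dyadArc (I : ℕ × ℕ) : IsOpen (dyadArc I) :=
  QuotientAddGroup.isOpenMap_coe _ isOpen_Ioo

lemma isPreconnected_dyadArc (I : ℕ × ℕ) : IsPreconnected (dyadArc I) :=
  isPreconnected_Ioo.image _ (AddCircle.continuous_mk' _).continuousOn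

lemma volume_dyadArc {I : ℕ × ℕ} (hI : dyad I.1 I.2 ⊆ Ioc 0 (2 * Real.pi)) :
    (volume (dyadArc I)).toReal = dyadLength I.1 := by
  have hsub : Ioo (dyadLength I.1 * I.2) (dyadLength I.1 * (I.2 + 1)) ⊆ Ioc 0 (2 * Real.pi) :=
    Ioo_subset_Ioc_self.trans hI
  rw [volume_eq_volume_preimage_inter (isOpen_dyadArc I).measurableSet]
  have : (fun x : ℝ => (x : UnitCircle)) ⁻¹' dyadArc I ∩ Ioc 0 (2 * Real.pi) =
      Ioo (dyadLength I.1 * I.2) (dyadLength I.1 * (I.2 + 1)) := by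
    ext x
    constructor
    · rintro ⟨⟨y, hy, hxy⟩, hx⟩
      exact coe_injOn_Ioc (hsub hy) hx hxy ▸ hy
    · exact fun hx => ⟨mem_image_of_mem _ hx, hsub hx⟩
  rw [this, Real.volume_Ioo, ENNReal.toReal_ofReal]
  · ring
  · have := dyadLength_pos I.1
    nlinarith

/-- The maximal saturated dyadic intervals contained in `(0, 2π]`. -/
def maximalArcs (h W : ℝ → ℝ) (n : ℕ) : Set (ℕ × ℕ) :=
  {I | I ∈ maximalSaturated h W n ∧ dyad I.1 I.2 ⊆ Ioc 0 (2 * Real.pi)}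

lemma dyadArc_disjoint {h W : ℝ → ℝ} {n : ℕ} {I J : ℕ × ℕ} (hI : I ∈ maximalArcs h W n)
    (hJ : J ∈ maximalArcs h W n) (hne : I ≠ J) : Disjoint (dyadArc I) (dyadArc J) := by
  rw [Set.disjoint_left]
  rintro _ ⟨x, hx, rfl⟩ ⟨y, hy, hxy⟩
  have hx' := Ioo_subset_Ioc_self hx
  have hy' := Ioo_subset_Ioc_self hy
  have := coe_injOn_Ioc (hJ.2 hy') (hI.2 hx') hxy
  subst this
  exact Set.disjoint_left.1 (maximalSaturated_disjoint hI.1 hJ.1 hne) hx' hy'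

/-- The complement on the circle of the maximal saturated open arcs. -/
def residualSet (h W : ℝ → ℝ) (n : ℕ) : Set UnitCircle := (⋃ I ∈ maximalArcs h W n, dyadArc I)ᶜ

lemma isHCarleson_residualSet {h W : ℝ → ℝ} (hg : IsGauge h) (hW : Measurable W)
    (hW0 : ∀ x, 0 ≤ W x) (n : ℕ) : IsHCarleson h (residualSet h W n) := by
  classical
  refine ⟨(isOpen_biUnion fun I _ => isOpen_dyadArc I).isClosed_compl,
    fun m => if Nat.unpair m ∈ maximalArcs h W n then dyadArc (Nat.unpair m) else ∅, fun m => ?_,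
    fun k l hkl => ?_, ?_, ?_⟩
  · dsimp only
    split_ifs
    · exact ⟨isOpen_dyadArc _, isPreconnected_dyadArc _⟩
    · exact ⟨isOpen_empty, isPreconnected_empty⟩
  · dsimp only
    split_ifs with h1 h2
    · exact dyadArc_disjoint h1 h2 fun he => hkl (Nat.pairEquiv.symm.injective he)
    all_goals simp
  · rw [residualSet, compl_compl]
    ext ζ
    simp only [mem_iUnion, exists_prop]
    constructor
    · rintro ⟨m, hm⟩
      split_ifs at hm with h1
      · exact ⟨_, h1, hm⟩
      · exact hm.elim
    · rintro ⟨I, hI, hζ⟩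
      refine ⟨Nat.pair I.1 I.2, ?_⟩
      simpa [hI] using hζ
  · have hterm : ∀ m, ENNReal.ofReal (h (volume (if Nat.unpair m ∈ maximalArcs h W n then
        dyadArc (Nat.unpair m) else ∅)).toReal) =
        (maximalArcs h W n).indicator (fun I => ENNReal.ofReal (h (dyadLength I.1)))
          (Nat.pairEquiv.symm m) := by
      intro m
      by_cases hm : Nat.unpair m ∈ maximalArcs h W n
      · rw [if_pos hm, volume_dyadArc hm.2]
        exact (indicator_of_mem (s := maximalArcs h W n) hm
          (fun I => ENNReal.ofReal (h (dyadLength I.1)))).symm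
      · rw [if_neg hm]
        have := indicator_of_notMem (s := maximalArcs h W n) hm
          (fun I => ENNReal.ofReal (h (dyadLength I.1)))
        simp only [measure_empty, ENNReal.toReal_zero, hg.zero, ENNReal.ofReal_zero]
        exact this.symm
    simp_rw [hterm]
    rw [Nat.pairEquiv.symm.tsum_eq
      ((maximalArcs h W n).indicator fun I => ENNReal.ofReal (h (dyadLength I.1)))]
    refine lt_of_le_of_lt ?_
      (ENNReal.ofReal_lt_top (r := 2 * Real.pi * (h (dyadLength n) / dyadLength n)))
    rw [ENNReal.tsum_eq_iSup_sum]
    refine iSup_le fun F => ?_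
    have hfilter := Finset.sum_indicator_eq_sum_filter F
      (fun _ I => ENNReal.ofReal (h (dyadLength I.1))) (fun _ => maximalArcs h W n) id
    simp only [id] at hfilter
    rw [hfilter, ← ENNReal.ofReal_sum_of_nonneg fun I _ => hg.nonneg (dyadLength_pos _).le]
    refine ENNReal.ofReal_le_ofReal ?_
    have := sum_add_setIntegral_truncLog_le (F := F.filter fun I => I ∈ maximalArcs h W n)
      (M := 0) (n := n) hg hW hW0 (fun I hI => (Finset.mem_filter.1 hI).2.1)
      (fun I hI => (Finset.mem_filter.1 hI).2.2)
    refine le_trans (le_add_of_nonneg_right ?_) this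
    exact integral_nonneg fun x => truncLog_nonneg W 0 x

lemma preimage_residualSet_subset {h W : ℝ → ℝ} (n : ℕ) :
    Ioc 0 (2 * Real.pi) ∩ (fun x : ℝ => (x : UnitCircle)) ⁻¹' residualSet h W n ⊆
      Ioc 0 (2 * Real.pi) ∩ unsaturatedSet h W n ∪
        range fun I : ℕ × ℕ => dyadLength I.1 * ((I.2 : ℝ) + 1) := by
  rintro x ⟨hx, hxr⟩
  by_cases hxu : x ∈ unsaturatedSet h W n
  · exact Or.inl ⟨hx, hxu⟩
  · right
    simp only [unsaturatedSet, mem_compl_iff, not_not, mem_iUnion] at hxu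
    obtain ⟨I, hI, hxI⟩ := hxu
    refine ⟨I, ?_⟩
    by_contra hne
    refine hxr (mem_biUnion (x := I) ⟨hI, ?_⟩ ?_)
    · rw [← dyad_zero] at hx ⊢
      exact dyad_subset_of_inter (Nat.zero_le _) hx hxI
    · exact ⟨x, ⟨hxI.1, lt_of_le_of_ne hxI.2 (Ne.symm hne)⟩, rfl⟩

lemma inter_unsaturatedSet_subset {h W : ℝ → ℝ} (n : ℕ) :
    Ioc 0 (2 * Real.pi) ∩ unsaturatedSet h W n ⊆
      (fun x : ℝ => (x : UnitCircle)) ⁻¹' residualSet h W n ∩ Ioc 0 (2 * Real.pi) := by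
  rintro x ⟨hx, hxu⟩
  refine ⟨fun hxr => hxu ?_, hx⟩
  simp only [mem_iUnion] at hxr
  obtain ⟨I, hI, y, hy, hxy⟩ := hxr
  have hy' := Ioo_subset_Ioc_self hy
  exact mem_biUnion hI.1 (coe_injOn_Ioc (hI.2 hy') hx hxy ▸ hy')

/-- Almost every point lies in a maximal saturated interval. -/
lemma volume_inter_unsaturatedSet {h : ℝ → ℝ} (hg : IsGauge h) {w : UnitCircle → ℝ}
    (hw : Measurable w) (hw0 : ∀ ζ, 0 ≤ w ζ)
    (hdiv : ∀ E : Set UnitCircle, IsHCarleson h E → 0 < volume E → ∫⁻ ζ in E, nlog (w ζ) = ⊤)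
    (n : ℕ) :
    volume (Ioc 0 (2 * Real.pi) ∩ unsaturatedSet h (fun x : ℝ => w x) n) = 0 := by
  have hW : Measurable fun x : ℝ => w x := hw.comp AddCircle.measurable_mk'
  have hW0 : ∀ x : ℝ, 0 ≤ w x := fun x => hw0 x
  have hC := isHCarleson_residualSet hg hW hW0 n
  have hmeas := hC.1.measurableSet
  have hlt : ∫⁻ ζ in residualSet h (fun x : ℝ => w x) n, nlog (w ζ) < ⊤ := by
    rw [setLIntegral_circle_eq hmeas]
    refine lt_of_le_of_lt (lintegral_mono_set (preimage_residualSet_subset n)) ?_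
    refine lt_of_le_of_lt (lintegral_union_le _ _ _) ?_
    have h0 : volume (range fun I : ℕ × ℕ => dyadLength I.1 * ((I.2 : ℝ) + 1)) = 0 :=
      (countable_range _).measure_zero _
    rw [setLIntegral_measure_zero _ _ h0, add_zero]
    exact setLIntegral_nlog_unsaturatedSet_lt_top hg hW hW0 n
  have h0 : volume (residualSet h (fun x : ℝ => w x) n) = 0 := by
    by_contra hne
    exact hlt.ne (hdiv _ hC (pos_iff_ne_zero.2 hne))
  rw [volume_eq_volume_preimage_inter hmeas] at h0
  exact measure_mono_null (inter_unsaturatedSet_subset n) h0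

lemma integrableOn_diskKernel_mul {z : ℂ} (hz : ‖z‖ < 1) {ρ : ℝ → ℝ} {s : Set ℝ}
    (hρ : IntegrableOn ρ s) : IntegrableOn (fun x => diskKernel z x * ρ x) s := by
  refine Integrable.bdd_mul (c := 2 / (1 - ‖z‖)) hρ
    (continuous_diskKernel hz).aestronglyMeasurable ?_
  filter_upwards with x
  rw [Real.norm_of_nonneg (diskKernel_pos hz x).le]
  exact diskKernel_le hz x

lemma integrableOn_diskKernel_dyad {z : ℂ} (hz : ‖z‖ < 1) (k j : ℕ) :
    IntegrableOn (diskKernel z) (dyad k j) := (continuous_diskKernel hz).integrableOn_Ioc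

section flow

variable {h W ρ : ℝ → ℝ} {k j : ℕ}

lemma IsFlow.setIntegral_diskKernel_mul_le (hρ : IsFlow h W k j ρ) {z : ℂ} (hz : ‖z‖ < 1)
    {k' j' : ℕ} (hsub : dyad k' j' ⊆ dyad k j) (hl : dyadLength k' ≤ 1 - ‖z‖) :
    ∫ x in dyad k' j', diskKernel z x * ρ x ≤
      (1 + 3 * dyadLength k' / (1 - ‖z‖)) * (h (dyadLength k') / dyadLength k') *
        ∫ x in dyad k' j', diskKernel z x := by
  have e : dyadLength k' * (j' + 1) - dyadLength k' * j' = dyadLength k' := by ring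
  have := _root_.setIntegral_diskKernel_mul_le hz
    (a := dyadLength k' * j') (b := dyadLength k' * (j' + 1)) (H := h (dyadLength k'))
    (by linarith [dyadLength_pos k']) (by rwa [e]) (hρ.integrableOn (volume_dyad_ne_top k' j'))
    hρ.nonneg (hρ.mass_le k' j' hsub)
  rwa [e] at this

/-- On a short dyadic interval the balanced distribution has small Poisson integral. -/
lemma IsFlow.balanced_le_of_short (hρ : IsFlow h W k j ρ) {z : ℂ} (hz : ‖z‖ < 1)
    (hl : dyadLength k ≤ 1 - ‖z‖) :
    ∫ x in dyad k j, diskKernel z x * (ρ x - h (dyadLength k) / dyadLength k) ≤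
      3 * h (dyadLength k) / (1 - ‖z‖) * ∫ x in dyad k j, diskKernel z x := by
  have h1 := hρ.setIntegral_diskKernel_mul_le hz Subset.rfl hl
  have hd : 0 < 1 - ‖z‖ := by linarith
  have hlen := dyadLength_pos k
  simp_rw [mul_sub]
  rw [integral_sub
    (integrableOn_diskKernel_mul hz (hρ.integrableOn (volume_dyad_ne_top k j)))
    ((integrableOn_diskKernel_dyad hz k j).mul_const _), integral_mul_const]
  have e : (1 + 3 * dyadLength k / (1 - ‖z‖)) * (h (dyadLength k) / dyadLength k) *
      (∫ x in dyad k j, diskKernel z x) =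
      (∫ x in dyad k j, diskKernel z x) * (h (dyadLength k) / dyadLength k) +
      3 * h (dyadLength k) / (1 - ‖z‖) * ∫ x in dyad k j, diskKernel z x := by
    field_simp
  linarith

lemma IsFlow.balanced_le (hg : IsGauge h) (hρ : IsFlow h W k j ρ) {z : ℂ} (hz : ‖z‖ < 1) :
    ∫ x in dyad k j, diskKernel z x * (ρ x - h (dyadLength k) / dyadLength k) ≤
      8 * h (1 - ‖z‖) / (1 - ‖z‖) * ∫ x in dyad k j, diskKernel z x := by
  have hd : 0 < 1 - ‖z‖ := by linarith
  have hK : ∀ k j, 0 ≤ ∫ x in dyad k j, diskKernel z x := fun k j =>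
    integral_nonneg fun x => (diskKernel_pos hz x).le
  have hmono : ∀ k, dyadLength k ≤ 1 - ‖z‖ → h (dyadLength k) ≤ h (1 - ‖z‖) := fun k hk =>
    hg.mono (mem_Ici.2 (dyadLength_pos k).le) (mem_Ici.2 hd.le) hk
  rcases le_or_gt (dyadLength k) (1 - ‖z‖) with hl | hl
  · refine (hρ.balanced_le_of_short hz hl).trans ?_
    have := hmono k hl
    have := hg.nonneg hd.le
    refine mul_le_mul_of_nonneg_right ?_ (hK k j)
    gcongr ?_ / _
    linarith
  · classical
    have hex : ∃ m, dyadLength (k + m) ≤ 1 - ‖z‖ := by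
      have h1 := (tendsto_nhdsWithin_iff.1 tendsto_dyadLength).1.eventually_le_const hd
      obtain ⟨N, hN⟩ := eventually_atTop.1 h1
      exact ⟨N, hN _ (Nat.le_add_left _ _)⟩
    obtain ⟨m, hm, hm'⟩ : ∃ m, dyadLength (k + m) ≤ 1 - ‖z‖ ∧
        1 - ‖z‖ ≤ 2 * dyadLength (k + m) := by
      refine ⟨Nat.find hex, Nat.find_spec hex, ?_⟩
      rcases hm : Nat.find hex with _ | m
      · have := Nat.find_spec hex
        rw [hm, add_zero] at this
        linarith
      · have := Nat.find_min hex (m := m) (by omega)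
        rw [not_le, dyadLength_eq_two_mul] at this
        exact this.le
    have hρi := hρ.integrableOn (volume_dyad_ne_top k j)
    have h1 : ∫ x in dyad k j, diskKernel z x * (ρ x - h (dyadLength k) / dyadLength k) ≤
        ∫ x in dyad k j, diskKernel z x * ρ x := by
      refine setIntegral_mono_on (integrableOn_diskKernel_mul hz
        (hρi.sub (integrableOn_const (volume_dyad_ne_top k j))))
        (integrableOn_diskKernel_mul hz hρi) (measurableSet_dyad k j) fun x _ => ?_
      refine mul_le_mul_of_nonneg_left ?_ (diskKernel_pos hz x).le
      have := div_nonneg (hg.nonneg (dyadLength_pos k).le) (dyadLength_pos k).le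
      linarith
    refine h1.trans ?_
    rw [← integral_const_mul]
    refine setIntegral_dyad_le_of_le m (integrableOn_diskKernel_mul hz hρi)
      ((integrableOn_diskKernel_dyad hz k j).const_mul _) fun i hi => ?_
    rw [integral_const_mul]
    refine (hρ.setIntegral_diskKernel_mul_le hz hi hm).trans ?_
    refine mul_le_mul_of_nonneg_right ?_ (hK _ _)
    set l := dyadLength (k + m)
    have hlpos : 0 < l := dyadLength_pos _
    have h2 := hmono _ hm
    have h3 : 1 + 3 * l / (1 - ‖z‖) ≤ 4 := by
      have : 3 * l / (1 - ‖z‖) ≤ 3 := by rw [div_le_iff₀ hd]; linarith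
      linarith
    have h4 : h l / l ≤ 2 * h (1 - ‖z‖) / (1 - ‖z‖) := by
      rw [div_le_div_iff₀ hlpos hd]
      have := hg.nonneg hd.le
      nlinarith
    calc (1 + 3 * l / (1 - ‖z‖)) * (h l / l) ≤ 4 * (2 * h (1 - ‖z‖) / (1 - ‖z‖)) := by
          have := div_nonneg (hg.nonneg hlpos.le) hlpos.le
          gcongr
      _ = 8 * h (1 - ‖z‖) / (1 - ‖z‖) := by ring

end flow

/-- Finitely many maximal saturated intervals exhaust a finite measure up to a small error. -/
lemma exists_finset_setLIntegral_le {h W : ℝ → ℝ} {n : ℕ} {g : ℝ → ENNReal}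
    (hfin : ∫⁻ x in Ioc 0 (2 * Real.pi), g x ≠ ⊤)
    (hnull : volume (Ioc 0 (2 * Real.pi) ∩ unsaturatedSet h W n) = 0) {η : ENNReal} (hη : 0 < η) :
    ∃ F : Finset (ℕ × ℕ), (∀ I ∈ F, I ∈ maximalArcs h W n) ∧
      ∫⁻ x in Ioc 0 (2 * Real.pi) \ ⋃ I ∈ F, dyad I.1 I.2, g x ≤ η := by
  classical
  set A : ℕ × ℕ → Set ℝ := fun I => if I ∈ maximalArcs h W n then dyad I.1 I.2 else ∅ with hA
  have hAm : ∀ I, MeasurableSet (A I) := fun I => by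
    simp only [hA]; split_ifs
    · exact measurableSet_dyad _ _
    · exact MeasurableSet.empty
  have hAd : Pairwise (Function.onFun Disjoint A) := fun I J hne => by
    simp only [hA, Function.onFun]; split_ifs with h1 h2
    · exact maximalSaturated_disjoint h1.1 h2.1 hne
    all_goals simp
  have hAs : ⋃ I, A I ⊆ Ioc 0 (2 * Real.pi) := iUnion_subset fun I => by
    simp only [hA]; split_ifs with h1
    · exact h1.2
    · exact empty_subset _
  have hsum : ∑' I, ∫⁻ x in A I, g x ≠ ⊤ := by
    rw [← lintegral_iUnion hAm hAd]
    exact ne_top_of_le_ne_top hfin (lintegral_mono_set hAs)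
  obtain ⟨F, hF⟩ := ((ENNReal.tendsto_tsum_compl_atTop_zero hsum).eventually_le_const hη).exists
  refine ⟨F.filter fun I => I ∈ maximalArcs h W n, fun I hI => (Finset.mem_filter.1 hI).2, ?_⟩
  have hsub : (Ioc 0 (2 * Real.pi) \ ⋃ I ∈ F.filter fun I => I ∈ maximalArcs h W n,
      dyad I.1 I.2) ⊆
      (Ioc 0 (2 * Real.pi) ∩ unsaturatedSet h W n) ∪ ⋃ I : {I // I ∉ F}, A I := by
    rintro x ⟨hx, hxF⟩
    by_cases hxu : x ∈ unsaturatedSet h W n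
    · exact Or.inl ⟨hx, hxu⟩
    · right
      simp only [unsaturatedSet, mem_compl_iff, not_not, mem_iUnion] at hxu
      obtain ⟨I, hI, hxI⟩ := hxu
      have hIm : I ∈ maximalArcs h W n := by
        refine ⟨hI, ?_⟩
        rw [← dyad_zero] at hx ⊢
        exact dyad_subset_of_inter (Nat.zero_le _) hx hxI
      have hIF : I ∉ F := fun hIF =>
        hxF (mem_biUnion (Finset.mem_coe.2 (Finset.mem_filter.2 ⟨hIF, hIm⟩)) hxI)
      exact mem_iUnion.2 ⟨⟨I, hIF⟩, by simpa [hA, hIm] using hxI⟩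
  calc _ ≤ ∫⁻ x in (Ioc 0 (2 * Real.pi) ∩ unsaturatedSet h W n) ∪ ⋃ I : {I // I ∉ F}, A I, g x :=
        lintegral_mono_set hsub
    _ ≤ (∫⁻ x in Ioc 0 (2 * Real.pi) ∩ unsaturatedSet h W n, g x) +
        ∫⁻ x in ⋃ I : {I // I ∉ F}, A I, g x := lintegral_union_le _ _ _
    _ = ∫⁻ x in ⋃ I : {I // I ∉ F}, A I, g x := by
        rw [setLIntegral_measure_zero _ _ hnull, zero_add]
    _ ≤ ∑' I : {I // I ∉ F}, ∫⁻ x in A I, g x := lintegral_iUnion_le _ _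
    _ ≤ η := hF

/-- The superposition over `F` of the distributions `ρ I`, each balanced to have mean zero on its
interval and scaled by `c`. -/
def balancedSum (h : ℝ → ℝ) (c : ℝ) (F : Finset (ℕ × ℕ)) (ρ : ℕ × ℕ → ℝ → ℝ) (x : ℝ) : ℝ :=
  ∑ I ∈ F, (dyad I.1 I.2).indicator
    (fun x => c * (ρ I x - h (dyadLength I.1) / dyadLength I.1)) x

section balancedSum

variable {h W : ℝ → ℝ} {n : ℕ} {F : Finset (ℕ × ℕ)} {ρ : ℕ × ℕ → ℝ → ℝ} {c : ℝ}

lemma measurable_balancedSum (hρ : ∀ I ∈ F, IsFlow h W I.1 I.2 (ρ I)) :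
    Measurable (balancedSum h c F ρ) :=
  Finset.measurable_fun_sum F fun I hI =>
    (((hρ I hI).measurable.sub_const _).const_mul c).indicator (measurableSet_dyad _ _)

lemma exists_abs_balancedSum_le (hρ : ∀ I ∈ F, IsFlow h W I.1 I.2 (ρ I)) :
    ∃ M, ∀ x, |balancedSum h c F ρ x| ≤ M := by
  choose! M hM using fun I hI => (hρ I hI).bounded
  refine ⟨∑ I ∈ F, |c| * (M I + |h (dyadLength I.1) / dyadLength I.1|), fun x => ?_⟩
  refine (Finset.abs_sum_le_sum_abs _ _).trans (Finset.sum_le_sum fun I hI => ?_)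
  have hx : |ρ I x| ≤ M I := by rw [abs_of_nonneg ((hρ I hI).nonneg x)]; exact hM I hI x
  have h0 : 0 ≤ M I := (abs_nonneg _).trans hx
  by_cases hxI : x ∈ dyad I.1 I.2
  · rw [indicator_of_mem hxI, abs_mul]
    exact mul_le_mul_of_nonneg_left ((abs_sub _ _).trans (by gcongr)) (abs_nonneg c)
  · rw [indicator_of_notMem hxI, abs_zero]
    positivity

lemma integral_mul_balancedSum (hF : ∀ I ∈ F, I ∈ maximalArcs h W n)
    (hρ : ∀ I ∈ F, IsFlow h W I.1 I.2 (ρ I)) {K : ℝ → ℝ} (hK : Continuous K) :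
    ∫ x in Ioc 0 (2 * Real.pi), K x * balancedSum h c F ρ x =
      ∑ I ∈ F, c * ∫ x in dyad I.1 I.2,
        K x * (ρ I x - h (dyadLength I.1) / dyadLength I.1) := by
  have hinteg : ∀ I ∈ F, IntegrableOn (fun x => K x * (c * (ρ I x -
      h (dyadLength I.1) / dyadLength I.1))) (dyad I.1 I.2) := fun I hI => by
    have h1 : IntegrableOn (fun x => c * (ρ I x -
        h (dyadLength I.1) / dyadLength I.1)) (dyad I.1 I.2) :=
      (((hρ I hI).integrableOn (volume_dyad_ne_top _ _)).sub
        (integrableOn_const (volume_dyad_ne_top _ _))).const_mul c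
    obtain ⟨C, hC⟩ := (isCompact_Icc (a := dyadLength I.1 * I.2)
      (b := dyadLength I.1 * (I.2 + 1))).exists_bound_of_continuousOn hK.continuousOn
    refine Integrable.bdd_mul (c := C) h1 hK.aestronglyMeasurable ?_
    filter_upwards [ae_restrict_mem (measurableSet_dyad _ _)] with x hx
    exact hC x (Ioc_subset_Icc_self hx)
  have e : ∀ x, K x * balancedSum h c F ρ x = ∑ I ∈ F, (dyad I.1 I.2).indicator
      (fun x => K x * (c * (ρ I x - h (dyadLength I.1) / dyadLength I.1))) x := fun x => by
    rw [balancedSum, Finset.mul_sum]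
    refine Finset.sum_congr rfl fun I _ => ?_
    rw [← indicator_mul_right]
  simp_rw [e]
  rw [integral_finsetSum]
  · refine Finset.sum_congr rfl fun I hI => ?_
    rw [setIntegral_indicator (measurableSet_dyad _ _), inter_eq_right.2 (hF I hI).2,
      ← integral_const_mul]
    exact integral_congr_ae (Eventually.of_forall fun x => by ring)
  · intro I hI
    exact ((integrable_indicator_iff (measurableSet_dyad _ _)).2 (hinteg I hI)).integrableOn

lemma integral_diskKernel_mul_balancedSum_le (hF : ∀ I ∈ F, I ∈ maximalArcs h W n)
    (hρ : ∀ I ∈ F, IsFlow h W I.1 I.2 (ρ I)) (hc : 0 ≤ c) {z : ℂ} (hz : ‖z‖ < 1) {B : ℝ}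
    (hB0 : 0 ≤ B) (hB : ∀ I ∈ F, ∫ x in dyad I.1 I.2,
      diskKernel z x * (ρ I x - h (dyadLength I.1) / dyadLength I.1) ≤
        B * ∫ x in dyad I.1 I.2, diskKernel z x) :
    ∫ x in Ioc 0 (2 * Real.pi), diskKernel z x * balancedSum h c F ρ x ≤
      2 * Real.pi * (c * B) := by
  rw [integral_mul_balancedSum hF hρ (continuous_diskKernel hz)]
  have h1 : ∑ I ∈ F, ∫ x in dyad I.1 I.2, diskKernel z x ≤ 2 * Real.pi := by
    rw [← integral_diskKernel hz, ← integral_biUnion_finset F (fun I _ => measurableSet_dyad _ _)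
      (fun I hI J hJ hne => maximalSaturated_disjoint (hF I hI).1 (hF J hJ).1 hne)
      (fun I _ => integrableOn_diskKernel_dyad hz _ _)]
    exact setIntegral_mono_set (continuous_diskKernel hz).integrableOn_Ioc
      (Eventually.of_forall fun x => (diskKernel_pos hz x).le)
      (iUnion₂_subset fun I hI => (hF I hI).2).eventuallyLE
  calc _ ≤ ∑ I ∈ F, c * (B * ∫ x in dyad I.1 I.2, diskKernel z x) :=
        Finset.sum_le_sum fun I hI => mul_le_mul_of_nonneg_left (hB I hI) hc
    _ = c * B * ∑ I ∈ F, ∫ x in dyad I.1 I.2, diskKernel z x := by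
        rw [Finset.mul_sum]; exact Finset.sum_congr rfl fun I _ => by ring
    _ ≤ c * B * (2 * Real.pi) := by gcongr
    _ = _ := by ring

lemma exp_mul_balancedSum_le (hg : IsGauge h) (hW : ∀ x, 0 ≤ W x)
    (hF : ∀ I ∈ F, I ∈ maximalArcs h W n) (hρ : ∀ I ∈ F, IsFlow h W I.1 I.2 (ρ I))
    {t : ℝ} (htc0 : 0 ≤ t * c) (htc : t * c ≤ 1) {I : ℕ × ℕ} (hI : I ∈ F) {x : ℝ}
    (hx : x ∈ dyad I.1 I.2) :
    Real.exp (t * balancedSum h c F ρ x) * W x ≤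
      Real.exp (-(t * c * (h (dyadLength n) / dyadLength n))) * (1 + W x) := by
  have e : balancedSum h c F ρ x = c * (ρ I x - h (dyadLength I.1) / dyadLength I.1) :=
    sum_indicator_eq_of_mem (fun J hJ => (hF J hJ).1) hI
      (fun I x => c * (ρ I x - h (dyadLength I.1) / dyadLength I.1)) hx
  have hr := hg.r1 (dyadLength_pos I.1) (dyadLength_antitone (hF I hI).1.1)
  have hn := (hρ I hI).nonneg x
  have h1 : Real.exp (t * balancedSum h c F ρ x) ≤
      Real.exp (-(t * c * (h (dyadLength n) / dyadLength n))) * Real.exp (ρ I x) := by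
    rw [e, ← Real.exp_add]
    refine Real.exp_le_exp.2 ?_
    nlinarith [mul_le_mul_of_nonneg_left hr htc0, mul_le_mul_of_nonneg_right htc hn]
  calc _ ≤ Real.exp (-(t * c * (h (dyadLength n) / dyadLength n))) * Real.exp (ρ I x) * W x := by
        gcongr; exact hW x
    _ = Real.exp (-(t * c * (h (dyadLength n) / dyadLength n))) * (W x * Real.exp (ρ I x)) := by
        ring
    _ ≤ _ := by
        gcongr
        exact ((hρ I hI).mul_exp_le x).trans (max_le (by linarith [hW x]) (by linarith))

end balancedSum

/-- A bounded boundary function of mean zero with controlled Poisson integral which is very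
negative on most of the mass of `W`. -/
lemma exists_boundary_function {h W : ℝ → ℝ} (hg : IsGauge h) (hW : ∀ x, 0 ≤ W x)
    (hfin : ∫⁻ x in Ioc 0 (2 * Real.pi), ENNReal.ofReal (W x) ≠ ⊤) {n : ℕ}
    (hnull : volume (Ioc 0 (2 * Real.pi) ∩ unsaturatedSet h W n) = 0) {t c : ℝ}
    (ht : 0 < t) (hc : 0 < c) (htc : t * c ≤ 1) {η : ENNReal} (hη : 0 < η) :
    ∃ u : ℝ → ℝ, Measurable u ∧ (∃ M, ∀ x, |u x| ≤ M) ∧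
      ∫ x in Ioc 0 (2 * Real.pi), u x = 0 ∧
      (∀ z : ℂ, ‖z‖ < 1 → ∫ x in Ioc 0 (2 * Real.pi), diskKernel z x * u x ≤
        2 * Real.pi * (c * (8 * h (1 - ‖z‖) / (1 - ‖z‖)))) ∧
      (∀ z : ℂ, ‖z‖ < 1 → dyadLength n ≤ 1 - ‖z‖ →
        ∫ x in Ioc 0 (2 * Real.pi), diskKernel z x * u x ≤
          2 * Real.pi * (c * (3 * h (dyadLength n) / (1 - ‖z‖)))) ∧
      ∫⁻ x in Ioc 0 (2 * Real.pi), ENNReal.ofReal (Real.exp (t * u x) * W x) ≤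
        ENNReal.ofReal (Real.exp (-(t * c * (h (dyadLength n) / dyadLength n)))) *
          (∫⁻ x in Ioc 0 (2 * Real.pi), ENNReal.ofReal (1 + W x)) + η := by
  obtain ⟨F, hF, hFη⟩ := exists_finset_setLIntegral_le hfin hnull hη
  choose! ρ hρ hmass using fun I hI => (hF I hI).1.2.1
  refine ⟨balancedSum h c F ρ, measurable_balancedSum hρ, exists_abs_balancedSum_le hρ, ?_, ?_, ?_,
    ?_⟩
  · have := integral_mul_balancedSum (c := c) hF hρ (K := fun _ => 1) continuous_const
    simp only [one_mul] at this
    rw [this]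
    refine Finset.sum_eq_zero fun I hI => ?_
    have := dyadLength_pos I.1
    rw [integral_sub ((hρ I hI).integrableOn (volume_dyad_ne_top _ _))
      (integrableOn_const (volume_dyad_ne_top _ _)), hmass I hI, setIntegral_const,
      volume_real_dyad, smul_eq_mul, mul_div_cancel₀ _ this.ne', sub_self, mul_zero]
  · intro z hz
    have hd : 0 < 1 - ‖z‖ := by linarith
    have := hg.nonneg hd.le
    exact integral_diskKernel_mul_balancedSum_le hF hρ hc.le hz (by positivity)
      fun I hI => (hρ I hI).balanced_le hg hz
  · intro z hz hn
    have hd : 0 < 1 - ‖z‖ := by linarith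
    have := hg.nonneg (dyadLength_pos n).le
    refine integral_diskKernel_mul_balancedSum_le hF hρ hc.le hz (by positivity) fun I hI => ?_
    have hle := dyadLength_antitone (hF I hI).1.1
    refine ((hρ I hI).balanced_le_of_short hz (hle.trans hn)).trans ?_
    have hm := hg.mono (mem_Ici.2 (dyadLength_pos _).le) (mem_Ici.2 (dyadLength_pos _).le) hle
    refine mul_le_mul_of_nonneg_right ?_ (integral_nonneg fun x => (diskKernel_pos hz x).le)
    gcongr
  · set A : Set ℝ := ⋃ I ∈ F, dyad I.1 I.2
    have hA : MeasurableSet A := F.measurableSet_biUnion fun I _ => measurableSet_dyad _ _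
    have hAs : A ⊆ Ioc 0 (2 * Real.pi) := iUnion₂_subset fun I hI => (hF I hI).2
    rw [← lintegral_inter_add_sdiff _ _ hA]
    refine add_le_add ?_ ?_
    · rw [inter_eq_right.2 hAs, ← lintegral_const_mul' _ _ ENNReal.ofReal_ne_top]
      refine (setLIntegral_mono' hA fun x hx => ?_).trans (lintegral_mono_set hAs)
      obtain ⟨I, hI, hxI⟩ := mem_iUnion₂.1 hx
      rw [← ENNReal.ofReal_mul (Real.exp_pos _).le]
      exact ENNReal.ofReal_le_ofReal
        (exp_mul_balancedSum_le hg hW hF hρ (by positivity) htc hI hxI)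
    · refine le_trans (le_of_eq ?_) hFη
      refine setLIntegral_congr_fun (measurableSet_Ioc.diff hA) fun x hx => ?_
      have : balancedSum h c F ρ x = 0 := Finset.sum_eq_zero fun I hI =>
        indicator_of_notMem (fun hxI => hx.2 (mem_biUnion (Finset.mem_coe.2 hI) hxI)) _
      simp [this]

lemma exists_polynomial_exp (Q : Polynomial ℂ) {κ : ℝ} (hκ : 0 < κ) :
    ∃ p : Polynomial ℂ, ∀ z : ℂ, ‖z‖ ≤ 1 →
      ‖p.eval z - Complex.exp (Q.eval z)‖ ≤ κ * ‖Complex.exp (Q.eval z)‖ := by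
  obtain ⟨B, hB⟩ := (isCompact_closedBall (0 : ℂ) 1).exists_bound_of_continuousOn
    Q.continuous.continuousOn
  have hB' : ∀ z : ℂ, ‖z‖ ≤ 1 → ‖Q.eval z‖ ≤ B := fun z hz => hB z (by simpa using hz)
  have h1 : ∀ᶠ n : ℕ in atTop, B ^ n / n.factorial * 2 < κ * Real.exp (-B) := by
    have := (FloorSemiring.tendsto_pow_div_factorial_atTop B).mul_const 2
    rw [zero_mul] at this
    exact this.eventually_lt_const (by positivity)
  have h2 : ∀ᶠ n : ℕ in atTop, 2 * B ≤ n := tendsto_natCast_atTop_atTop.eventually_ge_atTop _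
  obtain ⟨n, hn1, hn2⟩ := (h1.and h2).exists
  refine ⟨∑ m ∈ Finset.range n, Polynomial.C ((m.factorial : ℂ)⁻¹) * Q ^ m, fun z hz => ?_⟩
  have hz' := hB' z hz
  have e : (∑ m ∈ Finset.range n, Polynomial.C ((m.factorial : ℂ)⁻¹) * Q ^ m).eval z =
      ∑ m ∈ Finset.range n, Q.eval z ^ m / m.factorial := by
    rw [Polynomial.eval_finsetSum]
    refine Finset.sum_congr rfl fun m _ => ?_
    simp [div_eq_inv_mul]
  rw [e, norm_sub_rev]
  have hle : ‖Q.eval z‖ / n.succ ≤ 1 / 2 := by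
    rw [div_le_div_iff₀ (by positivity) (by norm_num)]
    push_cast
    linarith
  refine (Complex.exp_bound' hle).trans ?_
  calc ‖Q.eval z‖ ^ n / n.factorial * 2 ≤ B ^ n / n.factorial * 2 := by gcongr
    _ ≤ κ * Real.exp (-B) := hn1.le
    _ ≤ _ := by
      rw [Complex.norm_exp]
      gcongr
      linarith [Complex.abs_re_le_norm (Q.eval z), neg_abs_le (Q.eval z).re]

lemma circleEmbed_coe (x : ℝ) : circleEmbed (x : UnitCircle) = circleMap 0 1 x := by
  rw [circleEmbed, AddCircle.toCircle_apply_mk, Circle.coe_exp]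
  simp [circleMap]

lemma norm_circleEmbed (ζ : UnitCircle) : ‖circleEmbed ζ‖ = 1 := Circle.norm_coe _

lemma exists_polynomial_re_eq_fourier (c : ℂ) (k : ℤ) :
    ∃ Q : Polynomial ℂ, ∀ ζ : UnitCircle,
      (Q.eval (circleEmbed ζ)).re = (c * fourier k ζ).re := by
  have key : ∀ (m : ℕ) (ζ : UnitCircle), circleEmbed ζ ^ m = fourier (m : ℤ) ζ := fun m ζ => by
    rw [fourier_apply, natCast_zsmul, AddCircle.toCircle_nsmul, circleEmbed, Circle.coe_pow]
  obtain ⟨m, rfl | rfl⟩ := k.eq_nat_or_neg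
  · exact ⟨Polynomial.C c * Polynomial.X ^ m, fun ζ => by simp [key]⟩
  · refine ⟨Polynomial.C (starRingEnd ℂ c) * Polynomial.X ^ m, fun ζ => ?_⟩
    rw [fourier_neg, ← Complex.conj_re]
    simp [key]

lemma exists_polynomial_re_eq {g : C(UnitCircle, ℂ)}
    (hg : g ∈ Submodule.span ℂ (range (fourier (T := 2 * Real.pi)))) (c : ℂ) :
    ∃ Q : Polynomial ℂ, ∀ ζ : UnitCircle, (Q.eval (circleEmbed ζ)).re = (c * g ζ).re := by
  induction hg using Submodule.span_induction generalizing c with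
  | mem _ h =>
    obtain ⟨k, rfl⟩ := h
    exact exists_polynomial_re_eq_fourier c k
  | zero => exact ⟨0, fun ζ => by simp⟩
  | add f g _ _ hf hg =>
    obtain ⟨P, hP⟩ := hf c
    obtain ⟨Q, hQ⟩ := hg c
    exact ⟨P + Q, fun ζ => by
      rw [Polynomial.eval_add, Complex.add_re, hP, hQ, ContinuousMap.add_apply, mul_add,
        Complex.add_re]⟩
  | smul a f _ hf =>
    obtain ⟨Q, hQ⟩ := hf (c * a)
    exact ⟨Q, fun ζ => by rw [hQ, ContinuousMap.smul_apply, smul_eq_mul, mul_assoc]⟩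

/-- Continuous real functions on the circle are uniform limits of real parts of polynomials. -/
lemma exists_polynomial_re_sub_le (f : C(UnitCircle, ℝ)) {η : ℝ} (hη : 0 < η) :
    ∃ Q : Polynomial ℂ, (Q.eval 0).im = 0 ∧
      ∀ ζ : UnitCircle, |(Q.eval (circleEmbed ζ)).re - f ζ| ≤ η := by
  let F : C(UnitCircle, ℂ) := ⟨fun ζ => (f ζ : ℂ), by fun_prop⟩
  have hF : F ∈ (Submodule.span ℂ (range (fourier (T := 2 * Real.pi)))).topologicalClosure := by
    rw [span_fourier_closure_eq_top]; trivial
  obtain ⟨g, hg, hgF⟩ := Metric.mem_closure_iff.1 hF η hη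
  obtain ⟨Q, hQ⟩ := exists_polynomial_re_eq hg 1
  refine ⟨Q - Polynomial.C (((Q.eval 0).im : ℂ) * Complex.I), by simp, fun ζ => ?_⟩
  have h1 : ‖F ζ - g ζ‖ ≤ η := by
    rw [← dist_eq_norm]
    exact (ContinuousMap.dist_apply_le_dist ζ).trans hgF.le
  have h2 := (Complex.abs_re_le_norm _).trans h1
  have h3 : ((Q - Polynomial.C (((Q.eval 0).im : ℂ) * Complex.I)).eval (circleEmbed ζ)).re =
      (g ζ).re := by
    simp [hQ]
  rw [h3, abs_sub_comm]
  simpa [F, abs_sub_comm] using h2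

/-- Bounded measurable functions are approximated in a weighted `L¹` norm, within the same bounds,
by continuous ones. -/
lemma exists_continuous_lintegral_sub_le {U w : UnitCircle → ℝ} (hU : Measurable U) {M : ℝ}
    (hM : ∀ ζ, |U ζ| ≤ M) (hw : Measurable w) (hw0 : ∀ ζ, 0 ≤ w ζ) (hw1 : Integrable w volume)
    {η : ENNReal} (hη : η ≠ 0) :
    ∃ f : C(UnitCircle, ℝ), (∀ ζ, |f ζ| ≤ M) ∧
      ∫⁻ ζ, ENNReal.ofReal ((1 + w ζ) * |f ζ - U ζ|) ≤ η := by
  set d : UnitCircle → ENNReal := fun ζ => ENNReal.ofReal (1 + w ζ) with hd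
  have hdm : Measurable d := (measurable_const.add hw).ennreal_ofReal
  have hdfin : ∫⁻ ζ, d ζ ≠ ⊤ := ((integrable_const 1).add hw1).lintegral_lt_top.ne
  set ν := (volume : Measure UnitCircle).withDensity d
  have : IsFiniteMeasure ν := isFiniteMeasure_withDensity hdfin
  have hUi : Integrable U ν := Integrable.of_bound hU.aestronglyMeasurable M
    (Eventually.of_forall fun ζ => by simpa using hM ζ)
  obtain ⟨g, hg, -⟩ := hUi.exists_boundedContinuous_lintegral_sub_le hη
  have hM0 : 0 ≤ M := (abs_nonneg _).trans (hM 0)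
  refine ⟨⟨fun ζ => max (-M) (min (g ζ) M), by fun_prop⟩, fun ζ => ?_, ?_⟩
  · rw [abs_le]
    exact ⟨le_max_left _ _, max_le (by linarith) (min_le_right _ _)⟩
  · refine le_trans ?_ hg
    rw [lintegral_withDensity_eq_lintegral_mul _ hdm
      (g := fun ζ => ‖U ζ - g ζ‖ₑ) (hU.sub g.continuous.measurable).enorm]
    refine lintegral_mono fun ζ => ?_
    simp only [Pi.mul_apply, hd, ContinuousMap.coe_mk]
    rw [ENNReal.ofReal_mul (by linarith [hw0 ζ])]
    gcongr
    rw [← ofReal_norm, Real.norm_eq_abs]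
    refine ENNReal.ofReal_le_ofReal ?_
    have e : U ζ = max (-M) (min (U ζ) M) := by
      rw [min_eq_left (abs_le.1 (hM ζ)).2, max_eq_right (abs_le.1 (hM ζ)).1]
    conv_lhs => rw [e]
    rw [abs_sub_comm (U ζ)]
    refine (abs_max_sub_max_le_max _ _ _ _).trans ?_
    rw [sub_self, abs_zero, max_eq_right (abs_nonneg _)]
    refine (abs_min_sub_min_le_max _ _ _ _).trans ?_
    rw [sub_self, abs_zero, max_eq_left (abs_nonneg _)]

/-- Bounded measurable functions are approximated in a weighted `L¹` norm by real parts of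
polynomials with almost the same bound. -/
lemma exists_polynomial_lintegral_sub_le {U w : UnitCircle → ℝ} (hU : Measurable U) {M : ℝ}
    (hM : ∀ ζ, |U ζ| ≤ M) (hw : Measurable w) (hw0 : ∀ ζ, 0 ≤ w ζ) (hw1 : Integrable w volume)
    {η : ℝ} (hη : 0 < η) :
    ∃ Q : Polynomial ℂ, (Q.eval 0).im = 0 ∧ (∀ ζ, |(Q.eval (circleEmbed ζ)).re| ≤ M + 1) ∧
      ∫⁻ ζ, ENNReal.ofReal ((1 + w ζ) * |(Q.eval (circleEmbed ζ)).re - U ζ|) ≤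
        ENNReal.ofReal η := by
  obtain ⟨f, hfM, hf⟩ := exists_continuous_lintegral_sub_le hU hM hw hw0 hw1
    (η := ENNReal.ofReal (η / 2)) (by simpa using hη)
  have hd : Integrable (fun ζ => 1 + w ζ) volume := (integrable_const 1).add hw1
  set A := ∫ ζ, (1 + w ζ) with hA
  have hA0 : 0 ≤ A := integral_nonneg fun ζ => by simp only [Pi.zero_apply]; linarith [hw0 ζ]
  set κ := min 1 (η / 2 / (A + 1))
  have hκ : 0 < κ := by positivity
  obtain ⟨Q, hQ0, hQ⟩ := exists_polynomial_re_sub_le f hκ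
  refine ⟨Q, hQ0, fun ζ => ?_, ?_⟩
  · have h1 := (hQ ζ).trans (min_le_left _ _)
    have h2 := abs_sub_abs_le_abs_sub (Q.eval (circleEmbed ζ)).re (f ζ)
    linarith [hfM ζ]
  · have hfm : Measurable fun ζ => ENNReal.ofReal ((1 + w ζ) * |f ζ - U ζ|) :=
      ((measurable_const.add hw).mul (f.continuous.measurable.sub hU).abs).ennreal_ofReal
    calc _ ≤ ∫⁻ ζ, (ENNReal.ofReal ((1 + w ζ) * |f ζ - U ζ|) +
          ENNReal.ofReal (κ * (1 + w ζ))) := by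
          refine lintegral_mono fun ζ => ?_
          have h0 := hw0 ζ
          rw [← ENNReal.ofReal_add (by positivity) (by positivity)]
          refine ENNReal.ofReal_le_ofReal ?_
          have := abs_sub_le (Q.eval (circleEmbed ζ)).re (f ζ) (U ζ)
          nlinarith [hQ ζ, abs_nonneg (f ζ - U ζ)]
      _ = (∫⁻ ζ, ENNReal.ofReal ((1 + w ζ) * |f ζ - U ζ|)) +
          ENNReal.ofReal (κ * A) := by
          rw [lintegral_add_left hfm, hA, ← integral_const_mul,
            ofReal_integral_eq_lintegral_ofReal (hd.const_mul κ)]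
          exact Eventually.of_forall fun ζ => mul_nonneg hκ.le (by linarith [hw0 ζ])
      _ ≤ ENNReal.ofReal (η / 2) + ENNReal.ofReal (η / 2) := by
          refine add_le_add hf (ENNReal.ofReal_le_ofReal ?_)
          calc κ * A ≤ η / 2 / (A + 1) * (A + 1) := by
                gcongr
                · exact min_le_right _ _
                · linarith
            _ = η / 2 := by field_simp
      _ = ENNReal.ofReal η := by
          rw [← ENNReal.ofReal_add (by positivity) (by positivity), add_halves]

section poisson

variable {Q : Polynomial ℂ} {u : ℝ → ℝ}

lemma integrableOn_re_eval (Q : Polynomial ℂ) :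
    IntegrableOn (fun x => (Q.eval (circleMap 0 1 x)).re) (Ioc 0 (2 * Real.pi)) :=
  (Complex.continuous_re.comp (Q.continuous.comp (continuous_circleMap 0 1))).integrableOn_Ioc

lemma re_eval_le_of_le {M : ℝ} (hM : ∀ x, (Q.eval (circleMap 0 1 x)).re ≤ M) {z : ℂ}
    (hz : ‖z‖ < 1) : (Q.eval z).re ≤ M := by
  rw [re_eval_eq_integral Q hz]
  have h1 : ∫ x in Ioc 0 (2 * Real.pi), diskKernel z x * (Q.eval (circleMap 0 1 x)).re ≤
      ∫ x in Ioc 0 (2 * Real.pi), diskKernel z x * M :=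
    setIntegral_mono (integrableOn_diskKernel_mul hz (integrableOn_re_eval Q))
      ((continuous_diskKernel hz).integrableOn_Ioc.mul_const M) fun x =>
        mul_le_mul_of_nonneg_left (hM x) (diskKernel_pos hz x).le
  rw [integral_mul_const, integral_diskKernel hz] at h1
  rw [inv_mul_le_iff₀ (by positivity)]
  exact h1

lemma re_eval_le (hu : IntegrableOn u (Ioc 0 (2 * Real.pi))) {η B : ℝ}
    (hη : ∫ x in Ioc 0 (2 * Real.pi), |(Q.eval (circleMap 0 1 x)).re - u x| ≤ η) {z : ℂ}
    (hz : ‖z‖ < 1)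
    (hB : ∫ x in Ioc 0 (2 * Real.pi), diskKernel z x * u x ≤ 2 * Real.pi * B) :
    (Q.eval z).re ≤ B + η / (1 - ‖z‖) := by
  have hd : 0 < 1 - ‖z‖ := by linarith
  have hQu := (integrableOn_re_eval Q).sub hu
  have h1 : ∫ x in Ioc 0 (2 * Real.pi), diskKernel z x * ((Q.eval (circleMap 0 1 x)).re - u x) ≤
      2 / (1 - ‖z‖) * η := by
    calc _ ≤ ∫ x in Ioc 0 (2 * Real.pi), 2 / (1 - ‖z‖) *
          |(Q.eval (circleMap 0 1 x)).re - u x| := by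
          refine setIntegral_mono (integrableOn_diskKernel_mul hz hQu) (hQu.abs.const_mul _)
            fun x => ?_
          exact (mul_le_mul_of_nonneg_left (le_abs_self _) (diskKernel_pos hz x).le).trans
            (mul_le_mul_of_nonneg_right (diskKernel_le hz x) (abs_nonneg _))
      _ ≤ _ := by rw [integral_const_mul]; gcongr
  simp_rw [mul_sub] at h1
  rw [integral_sub (integrableOn_diskKernel_mul hz (integrableOn_re_eval Q))
    (integrableOn_diskKernel_mul hz hu)] at h1
  have hη0 : 0 ≤ η := (integral_nonneg fun x => abs_nonneg _).trans hη
  rw [re_eval_eq_integral Q hz, inv_mul_le_iff₀ (by positivity)]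
  have h2 : 2 / (1 - ‖z‖) * η ≤ 2 * Real.pi * (η / (1 - ‖z‖)) := by
    have : 0 ≤ η / (1 - ‖z‖) := by positivity
    calc 2 / (1 - ‖z‖) * η = 2 * (η / (1 - ‖z‖)) := by ring
      _ ≤ _ := by nlinarith [Real.pi_gt_three]
  linarith

lemma norm_eval_zero_le (hu : IntegrableOn u (Ioc 0 (2 * Real.pi))) {η : ℝ}
    (hη : ∫ x in Ioc 0 (2 * Real.pi), |(Q.eval (circleMap 0 1 x)).re - u x| ≤ η)
    (hu0 : ∫ x in Ioc 0 (2 * Real.pi), u x = 0) (hQ0 : (Q.eval 0).im = 0) :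
    ‖Q.eval 0‖ ≤ η := by
  have hη0 : 0 ≤ η := (integral_nonneg fun x => abs_nonneg _).trans hη
  have e : Q.eval 0 = ((Q.eval 0).re : ℂ) := Complex.ext (by simp) (by simp [hQ0])
  have hK : ∀ x, diskKernel 0 x = 1 := fun x => by simp [diskKernel_eq]
  have h1 := re_eval_eq_integral Q (z := 0) (by simp)
  simp_rw [hK, one_mul] at h1
  have h2 : ∫ x in Ioc 0 (2 * Real.pi), (Q.eval (circleMap 0 1 x)).re =
      ∫ x in Ioc 0 (2 * Real.pi), ((Q.eval (circleMap 0 1 x)).re - u x) := by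
    rw [integral_sub (integrableOn_re_eval Q) hu, hu0, sub_zero]
  rw [e, Complex.norm_real, Real.norm_eq_abs, h1, h2, abs_mul, abs_of_pos (by positivity),
    inv_mul_le_iff₀ (by positivity)]
  refine (abs_integral_le_integral_abs.trans hη).trans ?_
  nlinarith [Real.pi_gt_three]

end poisson

lemma exp_le_exp_add_mul {t a b B : ℝ} (ht : 0 ≤ t) (ha : a ≤ B) :
    Real.exp (t * a) ≤ Real.exp (t * b) + t * Real.exp (t * B) * |a - b| := by
  have h1 : Real.exp (t * a) * (1 + (t * b - t * a)) ≤ Real.exp (t * b) := by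
    have := Real.add_one_le_exp (t * b - t * a)
    calc _ ≤ Real.exp (t * a) * Real.exp (t * b - t * a) := by gcongr; linarith
      _ = _ := by rw [← Real.exp_add]; ring_nf
  have h2 : Real.exp (t * a) * (t * (a - b)) ≤ Real.exp (t * B) * (t * |a - b|) := by
    have h3 : Real.exp (t * a) ≤ Real.exp (t * B) := by gcongr
    calc _ ≤ Real.exp (t * a) * (t * |a - b|) := by gcongr; exact le_abs_self _
      _ ≤ _ := by gcongr
  nlinarith

/-- A polynomial whose exponential is small in the weighted mean, close to `1` inside the disk, and
subject to the growth restriction given by the gauge. -/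
lemma exists_polynomial_exponent {h : ℝ → ℝ} (hg : IsGauge h) {w : UnitCircle → ℝ}
    (hw : Measurable w) (hw0 : ∀ ζ, 0 ≤ w ζ) (hw1 : Integrable w volume)
    (hdiv : ∀ E : Set UnitCircle, IsHCarleson h E → 0 < volume E → ∫⁻ ζ in E, nlog (w ζ) = ⊤)
    {t c : ℝ} (ht : 0 < t) (hc : 0 < c) (htc : t * c ≤ 1) {τ : ℝ} (hτ : 0 < τ) :
    ∃ Q : Polynomial ℂ,
      (∀ z : ℂ, ‖z‖ < 1 → (Q.eval z).re ≤ 9 * c * (h (1 - ‖z‖) / (1 - ‖z‖))) ∧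
      (∀ z : ℂ, ‖z‖ < 1 → τ ≤ 1 - ‖z‖ → (Q.eval z).re ≤ τ / (1 - ‖z‖)) ∧
      ‖Q.eval 0‖ ≤ τ ∧
      ∫⁻ ζ, ENNReal.ofReal (Real.exp (t * (Q.eval (circleEmbed ζ)).re) * w ζ) ≤
        ENNReal.ofReal τ := by
  have hd : Integrable (fun ζ => 1 + w ζ) volume := (integrable_const 1).add hw1
  set A := ∫ ζ, (1 + w ζ) with hA
  have hA0 : 0 ≤ A := integral_nonneg fun ζ => by simp only [Pi.zero_apply]; linarith [hw0 ζ]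
  have hAeq : ∫⁻ x in Ioc 0 (2 * Real.pi), ENNReal.ofReal (1 + w (x : UnitCircle)) =
      ENNReal.ofReal A := by
    rw [hA, ofReal_integral_eq_lintegral_ofReal hd
      (Eventually.of_forall fun ζ => by simp only [Pi.zero_apply]; linarith [hw0 ζ]),
      lintegral_circle_eq]
  obtain ⟨n, ⟨hn1, hn2⟩, hn3⟩ : ∃ n, (3 * c * h (dyadLength n) ≤ τ / 2 ∧ dyadLength n ≤ τ) ∧
      Real.exp (-(t * c * (h (dyadLength n) / dyadLength n))) * A ≤ τ / 3 := by
    have l1 := hg.tendsto_dyadLength.const_mul (3 * c)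
    have l2 := (tendsto_nhdsWithin_iff.1 tendsto_dyadLength).1
    have l3 := ((Real.tendsto_exp_neg_atTop_nhds_zero.comp
      ((hg.r2.comp tendsto_dyadLength).const_mul_atTop (show 0 < t * c by positivity))).mul_const A)
    rw [mul_zero] at l1
    rw [zero_mul] at l3
    exact (((l1.eventually_le_const (by positivity)).and (l2.eventually_le_const hτ)).and
      (l3.eventually_le_const (by positivity))).exists
  have hfin : ∫⁻ x in Ioc 0 (2 * Real.pi), ENNReal.ofReal (w (x : UnitCircle)) ≠ ⊤ := by
    rw [← lintegral_circle_eq (fun ζ => ENNReal.ofReal (w ζ))]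
    exact hw1.lintegral_lt_top.ne
  obtain ⟨u, hum, ⟨M, hM⟩, hu0, hu8, hu3, huI⟩ := exists_boundary_function hg
    (W := fun x : ℝ => w x) (fun x => hw0 x) hfin
    (volume_inter_unsaturatedSet hg hw hw0 hdiv n) ht hc htc
    (η := ENNReal.ofReal (τ / 3)) (by simpa using hτ)
  rw [hAeq, ← ENNReal.ofReal_mul (Real.exp_pos _).le] at huI
  have hui : IntegrableOn u (Ioc 0 (2 * Real.pi)) :=
    integrableOn_of_bounded hum hM measure_Ioc_lt_top.ne
  obtain ⟨δ₀, hδ₀, hδ₀M⟩ : ∃ δ₀ > 0, (M + 1) / c ≤ h δ₀ / δ₀ := by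
    obtain ⟨δ₀, h1, h2⟩ := ((hg.r2.eventually_ge_atTop ((M + 1) / c)).and
      self_mem_nhdsWithin).exists
    exact ⟨δ₀, h2, h1⟩
  have hhδ₀ := hg.pos hδ₀
  set η := min (τ / 2) (min (c * h δ₀) (τ / 3 / (t * Real.exp (t * (M + 1)))))
  have hη : 0 < η := by positivity
  have hη1 : η ≤ τ / 2 := min_le_left _ _
  have hη2 : η ≤ c * h δ₀ := (min_le_right _ _).trans (min_le_left _ _)
  have hη3 : η ≤ τ / 3 / (t * Real.exp (t * (M + 1))) :=
    (min_le_right _ _).trans (min_le_right _ _)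
  set U : UnitCircle → ℝ := fun ζ => u (AddCircle.equivIoc (2 * Real.pi) 0 ζ)
  have hUm : Measurable U :=
    hum.comp (measurable_subtype_coe.comp (AddCircle.measurableEquivIoc (2 * Real.pi) 0).measurable)
  have hUu : ∀ x ∈ Ioc 0 (2 * Real.pi), U (x : UnitCircle) = u x := fun x hx => by
    have : (AddCircle.equivIoc (2 * Real.pi) 0 (x : UnitCircle) : ℝ) = x :=
      AddCircle.equivIoc_coe_of_mem (p := 2 * Real.pi) (a := 0) (by simpa using hx)
    simp only [U, this]
  obtain ⟨Q, hQ0, hQM, hQU⟩ := exists_polynomial_lintegral_sub_le hUm (M := M) (fun ζ => hM _)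
    hw hw0 hw1 hη
  have hQu : ∫ x in Ioc 0 (2 * Real.pi), |(Q.eval (circleMap 0 1 x)).re - u x| ≤ η := by
    have hi : IntegrableOn (fun x => |(Q.eval (circleMap 0 1 x)).re - u x|)
        (Ioc 0 (2 * Real.pi)) := ((integrableOn_re_eval Q).sub hui).abs
    rw [← ENNReal.ofReal_le_ofReal_iff hη.le, ofReal_integral_eq_lintegral_ofReal hi
      (Eventually.of_forall fun x => abs_nonneg _)]
    refine le_trans ?_ hQU
    rw [lintegral_circle_eq]
    refine setLIntegral_mono' measurableSet_Ioc fun x hx => ENNReal.ofReal_le_ofReal ?_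
    rw [hUu x hx, circleEmbed_coe]
    nlinarith [mul_nonneg (hw0 x) (abs_nonneg ((Q.eval (circleMap 0 1 x)).re - u x))]
  have hQM' : ∀ x, (Q.eval (circleMap 0 1 x)).re ≤ M + 1 := fun x => by
    rw [← circleEmbed_coe]
    exact (le_abs_self _).trans (hQM _)
  refine ⟨Q, fun z hz => ?_, fun z hz hzτ => ?_, ?_, ?_⟩
  · have hδ : 0 < 1 - ‖z‖ := by linarith
    have hhδ := hg.pos hδ
    rcases le_or_gt (1 - ‖z‖) δ₀ with hle | hlt
    · have h1 := hδ₀M.trans (hg.r1 hδ hle)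
      rw [div_le_iff₀ hc] at h1
      have h2 : 0 < h (1 - ‖z‖) / (1 - ‖z‖) := by positivity
      have := re_eval_le_of_le hQM' hz
      nlinarith
    · refine (re_eval_le hui hQu hz (hu8 z hz)).trans ?_
      have h1 : h δ₀ ≤ h (1 - ‖z‖) := hg.mono (mem_Ici.2 hδ₀.le) (mem_Ici.2 hδ.le) hlt.le
      have h2 : η / (1 - ‖z‖) ≤ c * h (1 - ‖z‖) / (1 - ‖z‖) := by
        gcongr
        exact hη2.trans (by gcongr)
      calc _ ≤ c * (8 * h (1 - ‖z‖) / (1 - ‖z‖)) + c * h (1 - ‖z‖) / (1 - ‖z‖) := by gcongr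
        _ = _ := by ring
  · have hδ : 0 < 1 - ‖z‖ := by linarith
    refine (re_eval_le hui hQu hz (hu3 z hz (hn2.trans hzτ))).trans ?_
    calc _ = (3 * c * h (dyadLength n) + η) / (1 - ‖z‖) := by ring
      _ ≤ _ := by gcongr; linarith
  · exact (norm_eval_zero_le hui hQu hu0 hQ0).trans (by linarith)
  · have hB : 0 < t * Real.exp (t * (M + 1)) := by positivity
    calc _ ≤ ∫⁻ ζ, (ENNReal.ofReal (Real.exp (t * U ζ) * w ζ) +
          ENNReal.ofReal (t * Real.exp (t * (M + 1))) *
            ENNReal.ofReal ((1 + w ζ) * |(Q.eval (circleEmbed ζ)).re - U ζ|)) := by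
          refine lintegral_mono fun ζ => ?_
          have h0 := hw0 ζ
          rw [← ENNReal.ofReal_mul hB.le, ← ENNReal.ofReal_add (by positivity) (by positivity)]
          refine ENNReal.ofReal_le_ofReal ?_
          have h1 := exp_le_exp_add_mul (b := U ζ) ht.le ((le_abs_self _).trans (hQM ζ))
          have h2 := mul_le_mul_of_nonneg_right h1 h0
          have h3 := mul_nonneg hB.le (abs_nonneg ((Q.eval (circleEmbed ζ)).re - U ζ))
          nlinarith
      _ = (∫⁻ ζ, ENNReal.ofReal (Real.exp (t * U ζ) * w ζ)) +
          ENNReal.ofReal (t * Real.exp (t * (M + 1))) *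
            ∫⁻ ζ, ENNReal.ofReal ((1 + w ζ) * |(Q.eval (circleEmbed ζ)).re - U ζ|) := by
          rw [lintegral_add_left, lintegral_const_mul' _ _ ENNReal.ofReal_ne_top]
          exact ((Real.measurable_exp.comp (hUm.const_mul t)).mul hw).ennreal_ofReal
      _ ≤ (ENNReal.ofReal (τ / 3) + ENNReal.ofReal (τ / 3)) + ENNReal.ofReal (τ / 3) := by
          refine add_le_add ?_ ?_
          · rw [lintegral_circle_eq]
            refine le_trans (le_of_eq ?_) (huI.trans (by gcongr))
            exact setLIntegral_congr_fun measurableSet_Ioc fun x hx => by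
              simp only [hUu x hx]
          · refine (mul_le_mul_right hQU _).trans ?_
            rw [← ENNReal.ofReal_mul hB.le]
            refine ENNReal.ofReal_le_ofReal ?_
            rw [mul_comm]
            exact (le_div_iff₀ hB).1 hη3
      _ = ENNReal.ofReal τ := by
          rw [← ENNReal.ofReal_add (by positivity) (by positivity),
            ← ENNReal.ofReal_add (by positivity) (by positivity)]
          ring_nf

/-- Smallness of the exponent inside the disk, by the Borel–Carathéodory inequality. -/
lemma norm_eval_le_of_re_le {Q : Polynomial ℂ} {τ η : ℝ} (hτ : 0 < τ) (hη : 0 < η)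
    (hη1 : η ≤ 1 / 2) (hτη : τ ≤ η / 2)
    (hre : ∀ z : ℂ, ‖z‖ < 1 → τ ≤ 1 - ‖z‖ → (Q.eval z).re ≤ τ / (1 - ‖z‖))
    (h0 : ‖Q.eval 0‖ ≤ τ) {z : ℂ} (hz : ‖z‖ ≤ 1 - η) : ‖Q.eval z‖ ≤ 12 * τ / η ^ 2 := by
  have hR : 0 < 1 - η / 2 := by linarith
  have hb := Complex.borelCaratheodory (f := fun z => Q.eval z) (M := 2 * τ / η) (R := 1 - η / 2)
    (z := z) (by positivity) Q.differentiable.differentiableOn (fun y hy => by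
      have hy' : ‖y‖ < 1 - η / 2 := by simpa using hy
      refine (hre y (by linarith) (by linarith)).trans ?_
      rw [div_le_div_iff₀ (by linarith) hη]
      nlinarith) hR (by simp; linarith)
  refine hb.trans ?_
  have hd : η / 2 ≤ 1 - η / 2 - ‖z‖ := by linarith
  have hz0 := norm_nonneg z
  have h1 : 2 * (2 * τ / η) * ‖z‖ / (1 - η / 2 - ‖z‖) ≤ 2 * (2 * τ / η) * 1 / (η / 2) := by
    gcongr; linarith
  have h2 : ‖Q.eval 0‖ * (1 - η / 2 + ‖z‖) / (1 - η / 2 - ‖z‖) ≤ τ * 2 / (η / 2) := by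
    gcongr; linarith
  have h3 : 2 * (2 * τ / η) * 1 / (η / 2) = 8 * τ / η ^ 2 := by field_simp; ring
  have h4 : τ * 2 / (η / 2) ≤ 4 * τ / η ^ 2 := by
    rw [div_le_div_iff₀ (by positivity) (by positivity)]
    have : τ * η ^ 2 * η ≤ τ * η ^ 2 * 1 := by gcongr; linarith
    nlinarith [mul_pos hτ hη, mul_pos (mul_pos hτ hη) hη]
  calc _ ≤ 8 * τ / η ^ 2 + 4 * τ / η ^ 2 := by linarith
    _ = _ := by ring

lemma exists_polynomial_splitting {h : ℝ → ℝ} (hg : IsGauge h) {w : UnitCircle → ℝ}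
    (hw : Measurable w) (hw0 : ∀ ζ, 0 ≤ w ζ) (hw1 : Integrable w volume)
    (hdiv : ∀ E : Set UnitCircle, IsHCarleson h E → 0 < volume E → ∫⁻ ζ in E, nlog (w ζ) = ⊤)
    {t ε : ℝ} (ht : 0 < t) (hε : 0 < ε) {η : ℝ} (hη : 0 < η) (hη1 : η ≤ 1 / 2) :
    ∃ p : Polynomial ℂ,
      ∫⁻ ζ, (‖p.eval (circleEmbed ζ)‖₊ : ENNReal) ^ t * ENNReal.ofReal (w ζ) ≤
        ENNReal.ofReal η ∧
      (∀ z : ℂ, ‖z‖ ≤ 1 - η → ‖p.eval z - 1‖ ≤ η) ∧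
      ∀ z : ℂ, ‖z‖ < 1 → ‖p.eval z‖ ≤ Real.exp (ε * h (1 - ‖z‖) / (1 - ‖z‖)) := by
  set c := min (1 / t) (ε / 10)
  have hc : 0 < c := by positivity
  have htc : t * c ≤ 1 := by
    calc t * c ≤ t * (1 / t) := by gcongr; exact min_le_left _ _
      _ = 1 := by field_simp
  have hcε : 10 * c ≤ ε := by linarith [min_le_right (1 / t) (ε / 10)]
  have hh1 := hg.pos one_pos
  set τ := min (η ^ 3 / 100) (η / 2 ^ t)
  have hτ : 0 < τ := by positivity
  have hτ1 : τ ≤ η ^ 3 / 100 := min_le_left _ _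
  have hτ2 : τ ≤ η / 2 ^ t := min_le_right _ _
  obtain ⟨Q, hQ1, hQ2, hQ3, hQ4⟩ := exists_polynomial_exponent hg hw hw0 hw1 hdiv ht hc htc hτ
  set κ := min (c * h 1) (η / 4)
  have hκ : 0 < κ := by positivity
  have hκ1 : κ ≤ c * h 1 := min_le_left _ _
  have hκ2 : κ ≤ η / 4 := min_le_right _ _
  obtain ⟨p, hp⟩ := exists_polynomial_exp Q hκ
  have hp' : ∀ z : ℂ, ‖z‖ ≤ 1 → ‖p.eval z‖ ≤ (1 + κ) * Real.exp (Q.eval z).re := fun z hz => by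
    have h1 := norm_le_norm_add_norm_sub' (p.eval z) (Complex.exp (Q.eval z))
    have h2 := hp z hz
    rw [Complex.norm_exp] at h1 h2
    linarith
  refine ⟨p, ?_, fun z hz => ?_, fun z hz => ?_⟩
  · calc _ ≤ ∫⁻ ζ, ENNReal.ofReal (2 ^ t) *
          ENNReal.ofReal (Real.exp (t * (Q.eval (circleEmbed ζ)).re) * w ζ) := by
          refine lintegral_mono fun ζ => ?_
          rw [ENNReal.ofReal_mul (Real.exp_pos _).le, ← mul_assoc]
          gcongr
          rw [← ENNReal.ofReal_mul (by positivity), ← enorm_eq_nnnorm, ← ofReal_norm,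
            ENNReal.ofReal_rpow_of_nonneg (norm_nonneg _) ht.le]
          refine ENNReal.ofReal_le_ofReal ?_
          have h1 : ‖p.eval (circleEmbed ζ)‖ ≤ 2 * Real.exp (Q.eval (circleEmbed ζ)).re :=
            (hp' _ (norm_circleEmbed ζ).le).trans (by gcongr; linarith)
          calc _ ≤ (2 * Real.exp (Q.eval (circleEmbed ζ)).re) ^ t := by gcongr
            _ = _ := by
              rw [Real.mul_rpow (by norm_num) (Real.exp_pos _).le, ← Real.exp_mul, mul_comm t]
      _ = ENNReal.ofReal (2 ^ t) *
          ∫⁻ ζ, ENNReal.ofReal (Real.exp (t * (Q.eval (circleEmbed ζ)).re) * w ζ) :=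
          lintegral_const_mul' _ _ ENNReal.ofReal_ne_top
      _ ≤ ENNReal.ofReal (2 ^ t) * ENNReal.ofReal τ := by gcongr
      _ ≤ ENNReal.ofReal η := by
          rw [← ENNReal.ofReal_mul (by positivity)]
          refine ENNReal.ofReal_le_ofReal ?_
          rw [mul_comm]
          exact (le_div_iff₀ (by positivity)).1 hτ2
  · have hτη : τ ≤ η / 2 := by nlinarith [mul_pos hη hη]
    have h1 := norm_eval_le_of_re_le hτ hη hη1 hτη hQ2 hQ3 hz
    have h2 : 12 * τ / η ^ 2 ≤ 12 * η / 100 := by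
      rw [div_le_div_iff₀ (by positivity) (by norm_num)]
      nlinarith
    have h3 := Complex.norm_exp_sub_one_le (x := Q.eval z) (by linarith)
    have h4 := hp z (by linarith)
    have h5 := norm_sub_le_norm_sub_add_norm_sub (p.eval z) (Complex.exp (Q.eval z)) 1
    have h6 := norm_le_norm_add_norm_sub' (Complex.exp (Q.eval z)) 1
    rw [norm_one] at h6
    have h7 : κ * ‖Complex.exp (Q.eval z)‖ ≤ η / 4 * 2 := by
      gcongr; linarith
    linarith
  · have hδ : 0 < 1 - ‖z‖ := by linarith
    have h1 : h 1 ≤ h (1 - ‖z‖) / (1 - ‖z‖) := by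
      simpa using hg.r1 hδ (by linarith [norm_nonneg z] : 1 - ‖z‖ ≤ 1)
    have h2 : 1 + κ ≤ Real.exp κ := by linarith [Real.add_one_le_exp κ]
    calc _ ≤ (1 + κ) * Real.exp (Q.eval z).re := hp' z hz.le
      _ ≤ Real.exp κ * Real.exp (Q.eval z).re := by gcongr
      _ = Real.exp (κ + (Q.eval z).re) := (Real.exp_add _ _).symm
      _ ≤ _ := by
        refine Real.exp_le_exp.2 ?_
        rw [mul_div_assoc]
        have := hQ1 z hz
        nlinarith [mul_le_mul_of_nonneg_left h1 hc.le]

/-- general splitting theorem. If `∫_E log w |dz| = -∞` for every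
`h`-Carleson set `E ⊆ 𝕋` of positive measure, then there is a sequence of polynomials
with (i) `∫_𝕋 |p_N|^t w |dz| → 0`, (ii) `p_N → 1` uniformly on compact subsets of `𝔻`,
and (iii) `|p_N(z)| ≤ exp(ε h(1-|z|)/(1-|z|))` on `𝔻`, uniformly in `N`. -/
theorem general_splitting (h : ℝ → ℝ) (hg : IsGauge h)
    (w : UnitCircle → ℝ) (hw0 : ∀ ζ, 0 ≤ w ζ) (hw1 : Integrable w volume)
    (t ε : ℝ) (ht : 0 < t) (hε : 0 < ε)
    (hdiv : ∀ E : Set UnitCircle, IsHCarleson h E → 0 < volume E →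
      ∫⁻ ζ in E, nlog (w ζ) = ⊤) :
    ∃ p : ℕ → Polynomial ℂ,
      Tendsto (fun N => ∫⁻ ζ, (‖(p N).eval (circleEmbed ζ)‖₊ : ENNReal) ^ t *
          ENNReal.ofReal (w ζ)) atTop (𝓝 0) ∧
      (∀ K : Set ℂ, K ⊆ Metric.ball 0 1 → IsCompact K →
        TendstoUniformlyOn (fun N z => (p N).eval z) (fun _ => 1) atTop K) ∧
      (∀ N : ℕ, ∀ z ∈ Metric.ball (0 : ℂ) 1,
        ‖(p N).eval z‖ ≤ Real.exp (ε * h (1 - ‖z‖) / (1 - ‖z‖))) := by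
  set w' : UnitCircle → ℝ := fun ζ => max 0 (hw1.1.mk w ζ)
  have hww' : w =ᵐ[volume] w' := by
    filter_upwards [hw1.1.ae_eq_mk] with ζ hζ
    simp only [w', ← hζ, max_eq_right (hw0 ζ)]
  have hwm : Measurable w' := measurable_const.max hw1.1.stronglyMeasurable_mk.measurable
  have hdiv' : ∀ E : Set UnitCircle, IsHCarleson h E → 0 < volume E →
      ∫⁻ ζ in E, nlog (w' ζ) = ⊤ := fun E hE hE0 => by
    rw [← hdiv E hE hE0]
    refine lintegral_congr_ae (ae_restrict_of_ae ?_)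
    filter_upwards [hww'] with ζ hζ
    rw [hζ]
  have hη : ∀ N : ℕ, 0 < 1 / ((N : ℝ) + 2) := fun N => by positivity
  have hη1 : ∀ N : ℕ, 1 / ((N : ℝ) + 2) ≤ 1 / 2 := fun N => by
    gcongr
    linarith [N.cast_nonneg (α := ℝ)]
  have hlim : Tendsto (fun N : ℕ => 1 / ((N : ℝ) + 2)) atTop (𝓝 0) :=
    tendsto_const_nhds.div_atTop
      (tendsto_atTop_add_const_right _ _ tendsto_natCast_atTop_atTop)
  choose p hp1 hp2 hp3 using fun N => exists_polynomial_splitting hg hwm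
    (fun ζ => le_max_left _ _) (hw1.congr hww') hdiv' ht hε (hη N) (hη1 N)
  refine ⟨p, ?_, fun K hK hKc => ?_, fun N z hz => hp3 N z (by simpa using hz)⟩
  · have hlim' := ENNReal.tendsto_ofReal hlim
    rw [ENNReal.ofReal_zero] at hlim'
    refine tendsto_of_tendsto_of_tendsto_of_le_of_le tendsto_const_nhds hlim'
      (fun _ => zero_le) fun N => ?_
    refine le_trans (le_of_eq (lintegral_congr_ae ?_)) (hp1 N)
    filter_upwards [hww'] with ζ hζ
    rw [hζ]
  · obtain ⟨r, hr, hKr⟩ : ∃ r < 1, ∀ z ∈ K, ‖z‖ ≤ r := by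
      rcases K.eq_empty_or_nonempty with rfl | hne
      · exact ⟨0, one_pos, by simp⟩
      · obtain ⟨z₀, hz₀, hmax⟩ := hKc.exists_isMaxOn hne continuous_norm.continuousOn
        exact ⟨‖z₀‖, by simpa using hK hz₀, fun z hz => hmax hz⟩
    rw [Metric.tendstoUniformlyOn_iff]
    intro e he
    filter_upwards [hlim.eventually_lt_const he,
      hlim.eventually_lt_const (show 0 < 1 - r by linarith)] with N hN1 hN2 z hz
    rw [dist_comm, dist_eq_norm]
    exact (hp2 N z (by linarith [hKr z hz])).trans_lt hN1
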